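/- arXiv:2508.17743 — 3 statements merged into one kernel-verified Lean document; each statement's English description precedes it below -/
import Mathlib

section
/- Let G be a simple graph on a finite vertex type and let e = uv be an edge of G. Then the permanental polynomial of the signless Laplacian matrix satisfies ψ(Q(G)) = ψ(Q(G − e)) − ψ(Q_v(G − e)) − ψ(Q_u(G − e)) + 2·ψ(Q_{uv}(G)) + 2·Σ_{C ∈ 𝔠_G(e)} (−1)^{|V(C)|}·ψ(Q_{V(C)}(G)). -/
open Polynomial Matrix

attribute [local instance] Classical.propDecidable

noncomputable section

/-- The permanent of a square matrix: `per M = ∑_{σ} ∏_i M i (σ i)`. -/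
def Matrix.per {n R : Type*} [Fintype n] [DecidableEq n] [CommRing R]
    (M : Matrix n n R) : R :=
  ∑ σ : Equiv.Perm n, ∏ i, M i (σ i)

/-- The characteristic polynomial `φ(M) = det (x·I - M)`. -/
def phi {n R : Type*} [Fintype n] [DecidableEq n] [CommRing R]
    (M : Matrix n n (Polynomial R)) : Polynomial R :=
  ((Polynomial.X : Polynomial R) • (1 : Matrix n n (Polynomial R)) - M).det

/-- The permanental polynomial `ψ(M) = per (x·I - M)`. -/
def psi {n R : Type*} [Fintype n] [DecidableEq n] [CommRing R]
    (M : Matrix n n (Polynomial R)) : Polynomial R :=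
  ((Polynomial.X : Polynomial R) • (1 : Matrix n n (Polynomial R)) - M).per

variable {V : Type*}

/-- The principal submatrix of `M` obtained by deleting the rows and columns indexed by `S`. -/
def delSub {R : Type*} (M : Matrix V V R) (S : Set V) :
    Matrix {w : V // w ∉ S} {w : V // w ∉ S} R :=
  M.submatrix Subtype.val Subtype.val

/-- `C` is a cycle of `G`: a subgraph of `G` that is connected, has nonempty vertex set,
and in which every vertex of `C` has degree exactly `2` in `C`. -/
def IsCycleSub (G : SimpleGraph V) (C : G.Subgraph) : Prop :=
  C.Connected ∧ C.verts.Nonempty ∧ ∀ w ∈ C.verts, (C.neighborSet w).ncard = 2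

variable [Fintype V] [DecidableEq V]

/-- The degree diagonal matrix `D(G)` of a graph. -/
def degMat (R : Type*) [CommRing R] (G : SimpleGraph V) [DecidableRel G.Adj] :
    Matrix V V R :=
  Matrix.diagonal fun w => (G.degree w : R)

/-- The signless Laplacian matrix `Q(G) = D(G) + A(G)`. -/
def qMat (R : Type*) [CommRing R] (G : SimpleGraph V) [DecidableRel G.Adj] :
    Matrix V V R :=
  degMat R G + G.adjMatrix R


namespace SLP
open Equiv Equiv.Perm SimpleGraph
theorem p_inv1 {V : Type*} (τ : Perm V) (w : V) : τ (τ⁻¹ w) = w := τ.apply_symm_apply w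
theorem p_inv2 {V : Type*} (τ : Perm V) (w : V) : τ⁻¹ (τ w) = w := τ.symm_apply_apply w

/-- Sum over permutations agreeing with `τ` on `S`. -/
theorem agree_sum {R : Type*} [CommRing R] (M : Matrix V V R) (S : Set V)
    [Fintype {w : V // w ∉ S}] [DecidableEq {w : V // w ∉ S}] (τ : Perm V)
    (hτ : ∀ i, i ∉ S → τ i = i) :
    (∑ σ : Perm V, if (∀ i ∈ S, σ i = τ i) then ∏ i with i ∉ S, M i (σ i) else 0)
      = (delSub M S).per := by
  rw [← Finset.sum_filter]
  unfold Matrix.per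
  symm
  have hτS : ∀ i ∈ S, τ i ∈ S := by
    intro i hi
    by_contra h
    exact h ((τ.injective (hτ _ h)).symm ▸ hi)
  have hτS' : ∀ i ∈ S, τ⁻¹ i ∈ S := by
    intro i hi
    by_contra h
    have := hτ _ h
    rw [SLP.p_inv1] at this
    exact h (this ▸ hi)
  refine Finset.sum_bij' (i := fun σ _ => (Perm.subtypeEquivSubtypePerm (fun w => w ∉ S) σ).1 * τ)
    (j := fun σ hσ => (Perm.subtypeEquivSubtypePerm (fun w => w ∉ S)).symm ⟨σ * τ⁻¹, ?_⟩)
    ?_ ?_ ?_ ?_ ?_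
  · intro a ha
    simp only [Finset.mem_filter] at hσ
    push Not at ha
    rw [Perm.mul_apply, hσ.2 _ (hτS' a ha), p_inv1]
  · intro σ _
    simp only [Finset.mem_filter, Finset.mem_univ, true_and]
    intro i hi
    rw [Perm.mul_apply, Perm.subtypeEquivSubtypePerm_apply_of_not_mem]
    simpa using hτS i hi
  · intros; simp
  · intro σ _
    rw [Equiv.symm_apply_eq]
    ext1
    simp
  · intro σ hσ
    rw [Equiv.apply_symm_apply]
    simp
  · intro σ _
    rw [← Finset.prod_subtype_of_mem (f := fun i => M i ((((Perm.subtypeEquivSubtypePerm (fun w => w ∉ S)) σ).1 * τ) i)) (p := fun i => i ∉ S) (s := Finset.univ.filter (· ∉ S)) (by simp)]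
    refine Finset.prod_bij (fun i _ => i) (by simp) (by simp) (by simp) ?_
    intro i _
    rw [Perm.mul_apply, hτ _ i.2, Perm.subtypeEquivSubtypePerm_apply_of_mem (p := fun w => w ∉ S) _ i.2]
    rfl

theorem agree_sum' {R : Type*} [CommRing R] (M : Matrix V V R) (S : Set V)
    [Fintype {w : V // w ∉ S}] [DecidableEq {w : V // w ∉ S}] (τ : Perm V)
    (hτ : ∀ i, i ∉ S → τ i = i) :
    (∑ σ : Perm V, if (∀ i ∈ S, σ i = τ i) then ∏ i, M i (σ i) else 0)
      = (∏ i with i ∈ S, M i (τ i)) * (delSub M S).per := by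
  rw [← agree_sum M S τ hτ, Finset.mul_sum]
  refine Finset.sum_congr rfl fun σ _ => ?_
  split_ifs with h
  · rw [← Finset.prod_filter_mul_prod_filter_not Finset.univ (· ∈ S)]
    congr 1
    refine Finset.prod_congr rfl fun i hi => ?_
    rw [h i (by simpa using hi)]
  · simp

/-- expansion along the two diagonal entries -/
theorem diag_expand {R : Type*} [CommRing R] (M N : Matrix V V R) (u v : V) (huv : u ≠ v)
    (hu : M u u = N u u - 1) (hv : M v v = N v v - 1)
    (h1 : N u v = 0) (h2 : N v u = 0)
    (hMN : ∀ i j, ¬ (i = u ∧ j = u) → ¬ (i = v ∧ j = v) → ¬ (i = u ∧ j = v) → ¬ (i = v ∧ j = u)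
      → M i j = N i j) :
    (∑ σ : Perm V, if σ u ≠ v ∧ σ v ≠ u then ∏ i, M i (σ i) else 0)
      = N.per - (delSub N {v}).per - (delSub N {u}).per + (delSub M {u, v}).per := by
  have hd : delSub M {u, v} = delSub N {u, v} := by
    ext1 ⟨i, hi⟩ ⟨j, hj⟩
    simp only [Set.mem_insert_iff, Set.mem_singleton_iff, not_or] at hi hj
    simp only [delSub, Matrix.submatrix_apply]
    exact hMN _ _ (by tauto) (by tauto) (by tauto) (by tauto)
  rw [hd, ← agree_sum N {v} 1 (by simp), ← agree_sum N {u} 1 (by simp),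
    ← agree_sum N {u, v} 1 (by simp), Matrix.per, ← Finset.sum_sub_distrib, ← Finset.sum_sub_distrib,
    ← Finset.sum_add_distrib]
  refine Finset.sum_congr rfl fun σ _ => ?_
  generalize hT : ({u, v} : Set V) = T
  generalize hA : ({u} : Set V) = A
  generalize hB : ({v} : Set V) = B
  have cT : (∀ i ∈ T, σ i = (1 : Perm V) i) ↔ σ u = u ∧ σ v = v := by subst hT; simp
  have cA : (∀ i ∈ A, σ i = (1 : Perm V) i) ↔ σ u = u := by subst hA; simp
  have cB : (∀ i ∈ B, σ i = (1 : Perm V) i) ↔ σ v = v := by subst hB; simp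
  have e1 : ∀ f : V → R, ∏ i, f i = f u * (f v * ∏ i with i ∉ T, f i) := by
    intro f
    rw [← Finset.mul_prod_erase _ _ (Finset.mem_univ u),
      ← Finset.mul_prod_erase _ _ (show v ∈ Finset.univ.erase u by simp [huv.symm])]
    congr 3
    ext i; simp [← hT, ← hA]; tauto
  have e2 : ∀ f : V → R, ∏ i with i ∉ B, f i
      = f u * ∏ i with i ∉ T, f i := by
    intro f
    rw [← Finset.mul_prod_erase _ _ (show u ∈ Finset.univ.filter (· ∉ B) by simp [← hB, huv])]
    congr 2
    ext i; simp [← hT, ← hB]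
  have e3 : ∀ f : V → R, ∏ i with i ∉ A, f i
      = f v * ∏ i with i ∉ T, f i := by
    intro f
    rw [← Finset.mul_prod_erase _ _ (show v ∈ Finset.univ.filter (· ∉ A) by simp [← hA, huv.symm])]
    congr 2
    ext i; simp [← hT, ← hA]; tauto
  have e4 : ∏ i with i ∉ T, M i (σ i) = ∏ i with i ∉ T, N i (σ i) := by
    refine Finset.prod_congr rfl fun i hi => ?_
    simp [← hT] at hi
    exact hMN _ _ (by tauto) (by tauto) (by tauto) (by tauto)
  rw [e1, e1, e2, e3, e4]
  generalize ∏ i with i ∉ T, N i (σ i) = P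
  have hi : σ u ≠ σ v := fun h => huv (σ.injective h)
  simp only [cT, cA, cB]
  by_cases a1 : σ u = v
  · have : σ v ≠ v := fun h => hi (a1.trans h.symm)
    simp [a1, h1, this, huv.symm]
  by_cases a2 : σ v = u
  · have : σ u ≠ u := fun h => hi (h.trans a2.symm)
    simp [a2, h2, this, huv]
  rw [if_pos ⟨a1, a2⟩]
  by_cases b1 : σ u = u <;> by_cases b2 : σ v = v
  · simp [b1, b2, hu, hv]; ring
  · rw [hMN v (σ v) (by tauto) (by tauto) (by tauto) (by tauto)]
    simp [b1, b2, hu, hv]; ring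
  · rw [hMN u (σ u) (by tauto) (by tauto) (by tauto) (by tauto)]
    simp [b1, b2, hu, hv]; ring
  · rw [hMN u (σ u) (by tauto) (by tauto) (by tauto) (by tauto), hMN v (σ v) (by tauto) (by tauto) (by tauto) (by tauto)]
    simp [b1, b2]
end SLP

namespace SLP
open Equiv Equiv.Perm SimpleGraph


/-- The subgraph traced out by a permutation. -/
def cycSub (G : SimpleGraph V) (τ : Perm V) : G.Subgraph where
  verts := {a | τ a ≠ a}
  Adj a b := G.Adj a b ∧ (τ a = b ∨ τ b = a)
  adj_sub h := h.1
  edge_vert := by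
    rintro a b ⟨h, h1 | h1⟩ h2
    · exact h.ne (h2.symm.trans h1)
    · exact h.ne (τ.injective (h2.trans h1.symm))
  symm := ⟨fun a b h => ⟨h.1.symm, h.2.symm⟩⟩

/-- Oriented cycles of `G` through the arc `u → v`, as cyclic permutations. -/
def cycPerms (G : SimpleGraph V) (u v : V) : Set (Perm V) :=
  {τ | τ.IsCycle ∧ τ u = v ∧ τ v ≠ u ∧ ∀ i, τ i ≠ i → G.Adj i (τ i)}

theorem cyc_sq_ne {G : SimpleGraph V} {u v : V} (huv : u ≠ v) {τ : Perm V} (h : τ ∈ cycPerms G u v) (w : V)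
    (hw : τ w ≠ w) : τ (τ w) ≠ w := by
  obtain ⟨hc, h1, h2, h3⟩ := h
  intro hh
  have hu : τ u ≠ u := by rw [h1]; exact huv.symm
  have := (hc.pow_eq_one_iff' (n := 2) hw).2 (by simpa [pow_two] using hh)
  have := (hc.pow_eq_one_iff' (n := 2) hu).1 this
  simp [pow_two, h1] at this
  exact h2 this

theorem cycSub_nbr {G : SimpleGraph V} {u v : V} {τ : Perm V} (h : τ ∈ cycPerms G u v) (w : V)
    (hw : τ w ≠ w) : (cycSub G τ).neighborSet w = {τ w, τ⁻¹ w} := by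
  obtain ⟨hc, h1, h2, h3⟩ := h
  ext b
  simp only [Subgraph.mem_neighborSet, cycSub, Set.mem_insert_iff, Set.mem_singleton_iff]
  constructor
  · rintro ⟨_, h | h⟩
    · exact Or.inl h.symm
    · right; rw [← h]; simp
  · rintro (rfl | rfl)
    · exact ⟨h3 _ hw, Or.inl rfl⟩
    · refine ⟨?_, Or.inr (by simp)⟩
      have := h3 (τ⁻¹ w) (by
        intro h; rw [SLP.p_inv1] at h
        apply hw; nth_rewrite 1 [h]; simp)
      rw [SLP.p_inv1] at this
      exact this.symm

theorem cycSub_isCycle {G : SimpleGraph V} {u v : V} (huv : u ≠ v) {τ : Perm V} (h : τ ∈ cycPerms G u v) :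
    IsCycleSub G (cycSub G τ) ∧ (cycSub G τ).Adj u v := by
  have h' := h
  obtain ⟨hc, h1, h2, h3⟩ := h
  have hu : τ u ≠ u := by rw [h1]; exact huv.symm
  have huV : u ∈ (cycSub G τ).verts := hu
  refine ⟨⟨?_, ⟨u, huV⟩, ?_⟩, ?_⟩
  · have key : ∀ n : ℕ, ∃ hm : (τ ^ n) u ∈ (cycSub G τ).verts,
        (cycSub G τ).coe.Reachable ⟨u, huV⟩ ⟨(τ ^ n) u, hm⟩ := by
      intro n
      induction n with
      | zero => exact ⟨huV, Reachable.refl _⟩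
      | succ n ih =>
        obtain ⟨hm, hr⟩ := ih
        have hadj : (cycSub G τ).Adj ((τ ^ n) u) ((τ ^ (n+1)) u) := by
          rw [pow_succ', Perm.mul_apply]
          exact ⟨h3 _ hm, Or.inl rfl⟩
        exact ⟨(cycSub G τ).edge_vert hadj.symm, hr.trans (SimpleGraph.Adj.reachable (by simpa using hadj))⟩
    rw [Subgraph.connected_iff']
    have : Nonempty (cycSub G τ).verts := ⟨⟨u, huV⟩⟩
    have hall : ∀ a : (cycSub G τ).verts, (cycSub G τ).coe.Reachable ⟨u, huV⟩ a := by
      rintro ⟨a, ha⟩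
      obtain ⟨n, hn⟩ := hc.exists_pow_eq hu ha
      subst hn
      exact (key n).2
    exact ⟨fun a b => (hall a).symm.trans (hall b)⟩
  · intro w hw
    rw [cycSub_nbr h' w hw, Set.ncard_pair]
    intro hh
    apply cyc_sq_ne huv h' w hw
    rw [hh]; simp
  · exact ⟨h1 ▸ h3 u hu, Or.inl h1⟩

theorem cycSub_injOn {G : SimpleGraph V} {u v : V} (huv : u ≠ v) : Set.InjOn (cycSub G) (cycPerms G u v) := by
  intro τ hτ ρ hρ heq
  have hu : τ u ≠ u := by rw [hτ.2.1]; exact huv.symm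
  have hverts : ∀ a, τ a ≠ a ↔ ρ a ≠ a := fun a => by
    have : a ∈ (cycSub G τ).verts ↔ a ∈ (cycSub G ρ).verts := by rw [heq]
    exact this
  have key : ∀ n : ℕ, τ ((τ ^ n) u) = ρ ((τ ^ n) u) := by
    intro n
    induction n with
    | zero => simp [hτ.2.1, hρ.2.1]
    | succ n ih =>
      rw [pow_succ', Perm.mul_apply]
      set a := (τ ^ n) u with ha
      have han : τ a ≠ a := by
        rw [ha, ← Perm.mul_apply, ← pow_succ', pow_succ, Perm.mul_apply]
        exact fun h => hu ((τ ^ n).injective h)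
      have hb : τ (τ a) ≠ τ a := fun h => han (τ.injective h)
      have hb' : ρ (τ a) ≠ τ a := (hverts _).1 hb
      have e1 := cycSub_nbr hτ (τ a) hb
      have e2 := cycSub_nbr hρ (τ a) hb'
      rw [heq, e2] at e1
      have : τ (τ a) ∈ ({ρ (τ a), ρ⁻¹ (τ a)} : Set V) := by rw [e1]; simp
      rcases this with h | h
      · exact h
      · exfalso
        have h' : τ (τ a) = ρ⁻¹ (τ a) := h
        rw [ih, SLP.p_inv2, ← ih] at h'
        exact cyc_sq_ne huv hτ a han h'
  ext1 a
  by_cases ha : τ a = a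
  · have := (hverts a).not.1 (by simpa using ha)
    push Not at this
    rw [ha, this]
  · obtain ⟨n, hn⟩ := hτ.1.exists_pow_eq hu ha
    rw [← hn]; exact key n

theorem cycSub_surj {G : SimpleGraph V} {u v : V} (C : G.Subgraph) (hC : IsCycleSub G C)
    (hadj : C.Adj u v) : ∃ τ ∈ cycPerms G u v, cycSub G τ = C := by
  have huv : u ≠ v := hadj.ne
  obtain ⟨hconn, hne, hdeg⟩ := hC
  have hns : ∀ w, C.spanningCoe.neighborSet w = C.neighborSet w := fun w => by ext; simp
  have hcyc : C.spanningCoe.IsCycles := by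
    rintro w ⟨x, hx⟩
    rw [hns] at hx ⊢
    exact hdeg w (C.edge_vert hx)
  have hadj' : C.spanningCoe.Adj u v := hadj
  have huc : u ∈ (C.spanningCoe.connectedComponentMk u).supp := by simp
  have hsupp : (C.spanningCoe.connectedComponentMk u).supp = C.verts := by
    ext a
    rw [ConnectedComponent.mem_supp_iff, ConnectedComponent.eq]
    constructor
    · intro h
      obtain ⟨p⟩ := h
      cases p with
      | nil => exact C.edge_vert hadj
      | cons h p => exact C.edge_vert h
    · intro ha
      have := (Subgraph.connected_iff'.1 hconn).preconnected ⟨a, ha⟩ ⟨u, C.edge_vert hadj⟩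
      exact this.map ⟨Subtype.val, fun {a b} h => by simpa using h⟩
  obtain ⟨p, hp, hpv⟩ := hcyc.exists_cycle_toSubgraph_verts_eq_connectedComponentSupp huc ⟨v, hadj'⟩
  obtain ⟨q, hq, hqs, hqv⟩ := hp.exists_isCycle_snd_verts_eq (w := v) (by
      rwa [hp.adj_toSubgraph_iff_of_isCycles hcyc (hpv ▸ huc)])
  rw [hpv, hsupp] at hqv
  set l := q.support.tail with hl
  have hlen : l.length = q.length := by simp [hl]
  have hge : 3 ≤ l.length := hlen ▸ hq.three_le_length
  have hnd : l.Nodup := hq.support_nodup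
  have hget : ∀ i (hi : i < l.length), l[i] = q.getVert (i + 1) := by
    intro i hi
    simp only [hl, List.getElem_tail]
    rw [Walk.support_getElem_eq_getVert]
  have hsup : ∀ a, l.formPerm a ≠ a ↔ a ∈ l := by
    intro a
    constructor
    · exact List.mem_of_formPerm_apply_ne
    · intro h
      rw [List.formPerm_apply_mem_ne_self_iff l hnd a h]; omega
  have hml : ∀ a, a ∈ l ↔ a ∈ C.verts := by
    intro a
    rw [← hqv, Walk.mem_verts_toSubgraph, hl]
    constructor
    · exact List.mem_of_mem_tail
    · intro h
      rw [← Walk.cons_tail_support] at h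
      rcases List.mem_cons.1 h with h | h
      · rw [h]; exact Walk.end_mem_tail_support hq.not_nil
      · exact h
  have hstep : ∀ a ∈ l, C.Adj a (l.formPerm a) := by
    intro a ha
    obtain ⟨i, hi, rfl⟩ := List.getElem_of_mem ha
    rw [List.formPerm_apply_getElem l hnd i hi]
    by_cases h : i + 1 < l.length
    · simp only [Nat.mod_eq_of_lt h]
      rw [hget, hget]
      exact q.adj_getVert_succ (by omega)
    · have h : i + 1 = l.length := by omega
      simp only [h, Nat.mod_self]
      rw [hget, hget, h, hlen, Walk.getVert_length]
      have := q.adj_getVert_succ (i := 0) (by omega)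
      simpa using this
  have hul : l[l.length - 1]'(by omega) = u := by
    rw [hget, Nat.sub_add_cancel (by omega), hlen, Walk.getVert_length]
  have h0 : l[0]'(by omega) = v := by rw [hget]; exact hqs
  have h1 : l.formPerm u = v := by
    have := List.formPerm_apply_getElem l hnd (l.length - 1) (by omega)
    rw [hul] at this
    rw [this]
    simp only [Nat.sub_add_cancel (show 1 ≤ l.length by omega), Nat.mod_self, h0]
  have h2 : l.formPerm v ≠ u := by
    have := List.formPerm_apply_getElem l hnd 0 (by omega)
    rw [h0] at this
    rw [this]
    simp only [zero_add, Nat.mod_eq_of_lt (show 1 < l.length by omega)]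
    intro h
    have := (hnd.getElem_inj_iff).1 (h.trans hul.symm)
    omega
  have hmem : l.formPerm ∈ cycPerms G u v :=
    ⟨List.isCycle_formPerm hnd (by omega), h1, h2, fun i hi => (hstep i ((hsup i).1 hi)).adj_sub⟩
  refine ⟨_, hmem, ?_⟩
  have hv : (cycSub G l.formPerm).verts = C.verts := by
    ext a
    exact (hsup a).trans (hml a)
  have hle : ∀ a b, (cycSub G l.formPerm).Adj a b → C.Adj a b := by
    rintro a b ⟨h, rfl | rfl⟩
    · exact hstep a ((hsup a).1 h.ne')
    · exact (hstep b ((hsup b).1 h.ne)).symm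
  refine Subgraph.ext hv ?_
  ext a b
  refine ⟨hle a b, fun h => ?_⟩
  have ha : a ∈ C.verts := C.edge_vert h
  have hcard := (cycSub_isCycle huv hmem).1.2.2 a (hv ▸ ha)
  have := Set.eq_of_subset_of_ncard_le (s := (cycSub G l.formPerm).neighborSet a)
    (t := C.neighborSet a) (fun b hb => hle a b hb) (by rw [hcard, hdeg a ha]) (Set.toFinite _)
  have hb : b ∈ C.neighborSet a := h
  rw [← this] at hb
  exact hb

theorem cycSub_bijOn {G : SimpleGraph V} {u v : V} (huv : u ≠ v) :
    Set.BijOn (cycSub G) (cycPerms G u v) {C : G.Subgraph | IsCycleSub G C ∧ C.Adj u v} :=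
  ⟨fun _ h => cycSub_isCycle huv h, cycSub_injOn huv, fun C hC => cycSub_surj C hC.1 hC.2⟩
end SLP

namespace SLP
open Equiv Equiv.Perm SimpleGraph

theorem cycle_sum {R : Type*} [CommRing R] (G : SimpleGraph V) (M : Matrix V V R) (u v : V)
    (huv : u ≠ v) (hM1 : ∀ i j, G.Adj i j → M i j = -1) (hM0 : ∀ i j, i ≠ j → ¬ G.Adj i j → M i j = 0) :
    (∑ σ : Perm V, if σ u = v ∧ σ v ≠ u then ∏ i, M i (σ i) else 0)
      = ∑ᶠ C ∈ {C : G.Subgraph | IsCycleSub G C ∧ C.Adj u v},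
          (-1 : R) ^ C.verts.ncard * (delSub M C.verts).per := by
  rw [← finsum_mem_eq_of_bijOn (cycSub G) (cycSub_bijOn (G := G) huv)
    (f := fun τ => (-1 : R) ^ (cycSub G τ).verts.ncard * (delSub M (cycSub G τ).verts).per)
    (fun _ _ => rfl)]
  have hT : (cycPerms G u v) = ((Finset.univ.filter (· ∈ cycPerms G u v) : Finset (Perm V)) : Set (Perm V)) := by
    ext; simp
  rw [hT, finsum_mem_coe_finset]
  have hin : ∀ τ ∈ (Finset.univ.filter (· ∈ cycPerms G u v) : Finset (Perm V)),
      (-1 : R) ^ (cycSub G τ).verts.ncard * (delSub M (cycSub G τ).verts).per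
      = ∑ σ : Perm V, if (∀ i ∈ (cycSub G τ).verts, σ i = τ i) then ∏ i, M i (σ i) else 0 := by
    intro τ hτ
    have hτ' : τ ∈ cycPerms G u v := by simpa using hτ
    rw [agree_sum' M (cycSub G τ).verts τ (fun i hi => by_contra fun h => hi h)]
    congr 1
    rw [Finset.prod_congr rfl (g := fun _ => (-1 : R)) (fun i hi => hM1 _ _ (hτ'.2.2.2 i (show i ∈ (cycSub G τ).verts by simpa using hi))),
      Finset.prod_const]
    congr 1
    rw [← Set.ncard_coe_finset]
    congr 1
    ext; simp
  rw [Finset.sum_congr rfl hin, Finset.sum_comm]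
  refine Finset.sum_congr rfl fun σ _ => ?_
  by_cases hz : ∏ i, M i (σ i) = 0
  · simp [hz]
  have hadj : ∀ i, σ i ≠ i → G.Adj i (σ i) := by
    intro i hi
    by_contra h
    exact hz (Finset.prod_eq_zero (Finset.mem_univ i) (hM0 _ _ hi.symm h))
  have hsupp : ∀ τ ∈ cycPerms G u v, τ u ≠ u ∧ τ v ≠ v := by
    intro τ hτ
    have hu : τ u ≠ u := by rw [hτ.2.1]; exact huv.symm
    refine ⟨hu, fun h => hu (τ.injective ?_)⟩
    rw [hτ.2.1, h]
  split_ifs with hc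
  · obtain ⟨h1, h2⟩ := hc
    have hu : σ u ≠ u := by rw [h1]; exact huv.symm
    have hsame : σ.SameCycle u v := ⟨1, by simpa using h1⟩
    rw [Finset.sum_eq_single (σ.cycleOf u)]
    · rw [if_pos]
      intro i hi
      have hi : σ.cycleOf u i ≠ i := hi
      rw [cycleOf_apply] at hi ⊢
      split_ifs at hi ⊢ <;> simp_all
    · intro τ hτ hne
      have hτ' : τ ∈ cycPerms G u v := by simpa using hτ
      rw [if_neg]
      intro hag
      apply hne
      refine cycle_is_cycleOf (by simpa using (hsupp τ hτ').1) ?_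
      rw [mem_cycleFactorsFinset_iff]
      exact ⟨hτ'.1, fun a ha => (hag a (by simpa [cycSub] using ha)).symm⟩
    · intro hn
      exfalso
      apply hn
      rw [Finset.mem_filter]
      refine ⟨Finset.mem_univ _, isCycle_cycleOf σ hu, by rw [cycleOf_apply_self, h1], ?_, ?_⟩
      · rw [hsame.cycleOf_apply]; exact h2
      · intro i hi
        rw [cycleOf_apply] at hi ⊢
        split_ifs at hi ⊢
        · exact hadj i hi
        · exact absurd rfl hi
  · symm
    apply Finset.sum_eq_zero
    intro τ hτ
    have hτ' : τ ∈ cycPerms G u v := by simpa using hτ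
    rw [if_neg]
    intro hag
    apply hc
    refine ⟨?_, ?_⟩
    · rw [hag u (hsupp τ hτ').1, hτ'.2.1]
    · rw [hag v (hsupp τ hτ').2]; exact hτ'.2.2.1

theorem swap_sum {R : Type*} [CommRing R] (M : Matrix V V R) (u v : V)
    (huv : u ≠ v) (h1 : M u v = -1) (h2 : M v u = -1) :
    (∑ σ : Perm V, if σ u = v ∧ σ v = u then ∏ i, M i (σ i) else 0)
      = (delSub M {u, v}).per := by
  have := agree_sum' M {u, v} (swap u v) (fun i hi => by
    simp at hi; exact swap_apply_of_ne_of_ne hi.1 hi.2)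
  have hp : ∀ S : Set V, S = {u, v} → (∏ i with i ∈ S, M i (swap u v i)) = 1 := by
    intro S hS
    have : (Finset.univ.filter (· ∈ S)) = ({u, v} : Finset V) := by ext; simp [hS]
    rw [this, Finset.prod_pair huv]
    simp [h1, h2]
  rw [hp _ rfl, one_mul] at this
  rw [← this]
  refine Finset.sum_congr rfl fun σ _ => ?_
  congr 1
  simp

theorem psi_delSub (Q : Matrix V V (Polynomial ℤ)) (S : Set V)
    [Fintype {w : V // w ∉ S}] [DecidableEq {w : V // w ∉ S}] :
    psi (delSub Q S) = (delSub ((Polynomial.X : Polynomial ℤ) • (1 : Matrix V V (Polynomial ℤ)) - Q) S).per := by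
  unfold psi
  congr 1
  ext1 i j
  simp [delSub, Matrix.one_apply, Subtype.ext_iff]

theorem ent_ne (G : SimpleGraph V) [DecidableRel G.Adj] (i j : V) (h : i ≠ j) :
    ((Polynomial.X : Polynomial ℤ) • (1 : Matrix V V (Polynomial ℤ)) - qMat (Polynomial ℤ) G) i j
      = if G.Adj i j then -1 else 0 := by
  simp [qMat, degMat, h, Matrix.diagonal_apply]
  split_ifs <;> simp

theorem ent_eq (G : SimpleGraph V) [DecidableRel G.Adj] (i : V) :
    ((Polynomial.X : Polynomial ℤ) • (1 : Matrix V V (Polynomial ℤ)) - qMat (Polynomial ℤ) G) i i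
      = Polynomial.X - (G.degree i : Polynomial ℤ) := by
  simp [qMat, degMat]

theorem deg_ends (G H : SimpleGraph V) [DecidableRel G.Adj] [DecidableRel H.Adj] (u v : V)
    (he : G.Adj u v) (hH : ∀ w, H.Adj u w ↔ G.Adj u w ∧ w ≠ v) :
    G.degree u = H.degree u + 1 := by
  have : H.neighborFinset u = (G.neighborFinset u).erase v := by
    ext w; simp [hH]; tauto
  rw [← card_neighborFinset_eq_degree, ← card_neighborFinset_eq_degree, this,
    Finset.card_erase_add_one (by simpa using he)]

theorem deg_other (G H : SimpleGraph V) [DecidableRel G.Adj] [DecidableRel H.Adj] (u : V)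
    (hH : ∀ w, H.Adj u w ↔ G.Adj u w) :
    G.degree u = H.degree u := by
  have : H.neighborFinset u = G.neighborFinset u := by
    ext w; simp [hH]
  rw [← card_neighborFinset_eq_degree, ← card_neighborFinset_eq_degree, this]

theorem main (G H : SimpleGraph V) [DecidableRel G.Adj] [DecidableRel H.Adj] (u v : V)
    (he : G.Adj u v)
    (hH : ∀ a b, H.Adj a b ↔ G.Adj a b ∧ ¬ (a = u ∧ b = v) ∧ ¬ (a = v ∧ b = u)) :
    psi (qMat (Polynomial ℤ) G) =
      psi (qMat (Polynomial ℤ) H)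
        - psi (delSub (qMat (Polynomial ℤ) H) {v})
        - psi (delSub (qMat (Polynomial ℤ) H) {u})
        + 2 * psi (delSub (qMat (Polynomial ℤ) G) {u, v})
        + 2 * ∑ᶠ C ∈ {C : G.Subgraph | IsCycleSub G C ∧ C.Adj u v},
          (-1 : Polynomial ℤ) ^ C.verts.ncard * psi (delSub (qMat (Polynomial ℤ) G) C.verts) := by
  have huv : u ≠ v := he.ne
  simp only [psi_delSub]
  rw [psi, psi]
  have M1 := ent_ne G
  have M2 := ent_eq G
  have N1 := ent_ne H
  have N2 := ent_eq H
  generalize (Polynomial.X : Polynomial ℤ) • (1 : Matrix V V (Polynomial ℤ)) - qMat (Polynomial ℤ) G = M at *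
  generalize (Polynomial.X : Polynomial ℤ) • (1 : Matrix V V (Polynomial ℤ)) - qMat (Polynomial ℤ) H = N at *
  have hM1 : ∀ i j, G.Adj i j → M i j = -1 := fun i j h => by rw [M1 i j h.ne, if_pos h]
  have hM0 : ∀ i j, i ≠ j → ¬ G.Adj i j → M i j = 0 := fun i j h h' => by rw [M1 i j h, if_neg h']
  have D := diag_expand M N u v huv
    (by rw [M2, N2, deg_ends G H u v he (fun w => by rw [hH]; have := huv; tauto)]; push_cast; ring)
    (by rw [M2, N2, deg_ends G H v u he.symm (fun w => by rw [hH]; have := huv.symm; tauto)]; push_cast; ring)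
    (by rw [N1 _ _ huv, if_neg]; rw [hH]; tauto)
    (by rw [N1 _ _ huv.symm, if_neg]; rw [hH]; tauto)
    (by
      intro i j a1 a2 a3 a4
      by_cases hij : i = j
      · subst hij
        rw [M2, N2, deg_other G H i (fun w => by rw [hH]; tauto)]
      · rw [M1 _ _ hij, N1 _ _ hij]
        have : H.Adj i j ↔ G.Adj i j := by rw [hH]; tauto
        simp only [this])
  have S := swap_sum M u v huv (hM1 _ _ he) (hM1 _ _ he.symm)
  have C1 := cycle_sum G M u v huv hM1 hM0
  have C2 := cycle_sum G M v u huv.symm hM1 hM0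
  have hset : {C : G.Subgraph | IsCycleSub G C ∧ C.Adj v u} = {C : G.Subgraph | IsCycleSub G C ∧ C.Adj u v} := by
    ext C; simp [Subgraph.adj_comm]
  rw [hset] at C2
  have T : M.per = (∑ σ : Perm V, if σ u ≠ v ∧ σ v ≠ u then ∏ i, M i (σ i) else 0)
      + (∑ σ : Perm V, if σ u = v ∧ σ v = u then ∏ i, M i (σ i) else 0)
      + (∑ σ : Perm V, if σ u = v ∧ σ v ≠ u then ∏ i, M i (σ i) else 0)
      + (∑ σ : Perm V, if σ v = u ∧ σ u ≠ v then ∏ i, M i (σ i) else 0) := by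
    rw [Matrix.per, ← Finset.sum_add_distrib, ← Finset.sum_add_distrib, ← Finset.sum_add_distrib]
    refine Finset.sum_congr rfl fun σ _ => ?_
    by_cases a : σ u = v <;> by_cases b : σ v = u <;> simp [a, b]
  rw [T, D, S, C1, C2]
  ring
end SLP

theorem signless_laplacian_permanental_edge_recursion
    {V : Type*} [Fintype V] [DecidableEq V]
    (G : SimpleGraph V) [DecidableRel G.Adj] (u v : V) (he : G.Adj u v) :
    psi (qMat (Polynomial ℤ) G) =
      psi (qMat (Polynomial ℤ) (G.deleteEdges {s(u, v)}))
        - psi (delSub (qMat (Polynomial ℤ) (G.deleteEdges {s(u, v)})) {v})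
        - psi (delSub (qMat (Polynomial ℤ) (G.deleteEdges {s(u, v)})) {u})
        + 2 * psi (delSub (qMat (Polynomial ℤ) G) {u, v})
        + 2 * ∑ᶠ C ∈ {C : G.Subgraph | IsCycleSub G C ∧ C.Adj u v},
          (-1 : Polynomial ℤ) ^ C.verts.ncard * psi (delSub (qMat (Polynomial ℤ) G) C.verts) := by
  refine SLP.main G _ u v he (fun a b => ?_)
  simp only [SimpleGraph.deleteEdges_adj, Set.mem_singleton_iff, Sym2.eq_iff]
  tauto
end
end

section
/- Let G be a simple graph on a finite vertex type and let e = uv be an edge of G. Then the characteristic polynomial of the adjacency matrix satisfies φ(A(G)) = φ(A(G − e)) − φ(A(G − u − v)) − 2·Σ_{C ∈ 𝔠_G(e)} φ(A(G − V(C))). -/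
open Polynomial Matrix

attribute [local instance] Classical.propDecidable

noncomputable section

variable {V : Type*}

variable [Fintype V] [DecidableEq V]

open Equiv Equiv.Perm in
theorem aux_fiber {W R : Type*} [Fintype W] [DecidableEq W] [CommRing R] (M : Matrix W W R)
    (u : W) (c : Perm W) (hc : c.IsCycle) (hu : c u ≠ u) :
    ∑ σ : Perm W with σ.cycleOf u = c, ((sign σ : ℤ) : R) * ∏ i, M (σ i) i =
      ((sign c : ℤ) : R) * (∏ i ∈ c.support, M (c i) i) * (delSub M (c.support : Set W)).det := by
  rw [Matrix.det_apply', Finset.mul_sum]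
  symm
  have hfix : ∀ (τ : Perm {w : W // w ∉ (c.support : Set W)}) (i : W), c i ≠ i →
      ofSubtype τ i = i := by
    intro τ i hi
    apply ofSubtype_apply_of_not_mem
    simpa using hi
  have hdisj : ∀ τ : Perm {w : W // w ∉ (c.support : Set W)}, Disjoint c (ofSubtype τ) := by
    intro τ i
    by_cases hi : c i = i
    · exact Or.inl hi
    · exact Or.inr (hfix τ i hi)
  refine Finset.sum_bij (fun τ _ => c * ofSubtype τ) ?_ ?_ ?_ ?_
  · intro τ _
    simp only [Finset.mem_filter, Finset.mem_univ, true_and]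
    rw [cycleOf_mul_of_apply_right_eq_self (hdisj τ).commute u (hfix τ u hu), hc.cycleOf_eq hu]
  · intro τ _ τ' _ h
    exact ofSubtype_injective (mul_left_cancel h)
  · intro σ hσ
    simp only [Finset.mem_filter, Finset.mem_univ, true_and] at hσ
    have hag : ∀ i, c i ≠ i → c i = σ i := by
      intro i hi
      by_cases hs : σ.SameCycle u i
      · rw [← hσ, hs.cycleOf_apply]
      · exact absurd (by rw [← hσ, cycleOf_apply_of_not_sameCycle hs]) hi
    set ρ : Perm W := c⁻¹ * σ with hρ
    have hρfix : ∀ i, c i ≠ i → ρ i = i := by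
      intro i hi
      simp [hρ, ← hag i hi]
    have hρ1 : ∀ x, (ρ x ∉ (c.support : Set W)) ↔ (x ∉ (c.support : Set W)) := by
      intro x
      simp only [Finset.mem_coe, mem_support, not_not]
      constructor
      · intro h
        by_contra hx
        rw [hρfix x hx] at h
        exact hx h
      · intro h
        by_contra hx
        have := hρfix _ hx
        rw [ρ.injective this] at hx
        exact hx h
    refine ⟨ρ.subtypePerm hρ1, Finset.mem_univ _, ?_⟩
    rw [ofSubtype_subtypePerm]
    · simp [hρ]
    · intro x hx h
      exact hx (hρfix x (by simpa using h))
  · intro τ _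
    rw [Perm.sign_mul, sign_ofSubtype]
    have h1 : ∏ i, M ((c * ofSubtype τ) i) i =
        (∏ i ∈ c.support, M (c i) i) *
          ∏ i, (delSub M (c.support : Set W)) (τ i) i := by
      rw [← Finset.prod_mul_prod_compl c.support]
      congr 1
      · apply Finset.prod_congr rfl
        intro i hi
        rw [Perm.mul_apply, hfix τ i (by simpa using hi)]
      · rw [Finset.prod_subtype (p := fun w => w ∉ (c.support : Set W)) (c.support)ᶜ (by simp)]
        apply Finset.prod_congr rfl
        intro i _
        have h2 : ofSubtype τ (i : W) = (τ i : W) := by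
          rw [ofSubtype_apply_of_mem τ i.2]
        have h3 : c (τ i : W) = (τ i : W) := by
          have := (τ i).2
          simpa using this
        rw [Perm.mul_apply, h2, h3]
        rfl
    rw [h1]
    push_cast
    ring

open Equiv Equiv.Perm in
theorem aux_det {W R : Type*} [Fintype W] [DecidableEq W] [CommRing R] (M M' : Matrix W W R)
    (u v : W) (huv : u ≠ v) (h1 : M' u v = 0) (h2 : M' v u = 0)
    (h3 : ∀ i j, ¬ (i = u ∧ j = v) → ¬ (i = v ∧ j = u) → M i j = M' i j) :
    M.det = M'.det + ∑ c : Perm W with c.IsCycle ∧ (c u = v ∨ c v = u),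
      ((sign c : ℤ) : R) * (∏ i ∈ c.support, M (c i) i) *
        (delSub M (c.support : Set W)).det := by
  have key : ∑ c : Perm W with c.IsCycle ∧ (c u = v ∨ c v = u),
      ((sign c : ℤ) : R) * (∏ i ∈ c.support, M (c i) i) *
        (delSub M (c.support : Set W)).det =
      ∑ σ : Perm W with (σ u = v ∨ σ v = u), ((sign σ : ℤ) : R) * ∏ i, M (σ i) i := by
    rw [← Finset.sum_fiberwise_of_maps_to (g := fun σ : Perm W => σ.cycleOf u)
      (t := Finset.univ.filter fun c : Perm W => c.IsCycle ∧ (c u = v ∨ c v = u))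
      (s := Finset.univ.filter fun σ : Perm W => (σ u = v ∨ σ v = u))]
    · apply Finset.sum_congr rfl
      intro c hc
      simp only [Finset.mem_filter, Finset.mem_univ, true_and] at hc
      have hu : c u ≠ u := by
        rcases hc.2 with h | h
        · rw [h]; exact huv.symm
        · intro h'
          exact huv (c.injective (h'.trans h.symm))
      rw [← aux_fiber M u c hc.1 hu]
      apply Finset.sum_congr _ (fun _ _ => rfl)
      ext σ
      simp only [Finset.mem_filter, Finset.mem_univ, true_and]
      constructor
      · intro h
        refine ⟨?_, h⟩
        rcases hc.2 with h' | h'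
        · left
          rw [← h', ← h, cycleOf_apply_self]
        · right
          have hs : σ.SameCycle u v := by
            by_contra hs
            rw [← h, cycleOf_apply_of_not_sameCycle hs] at h'
            exact huv h'.symm
          rw [← hs.cycleOf_apply, h, h']
      · exact fun h => h.2
    · intro σ hσ
      simp only [Finset.mem_filter, Finset.mem_univ, true_and] at hσ ⊢
      have hu : σ u ≠ u := by
        rcases hσ with h | h
        · rw [h]; exact huv.symm
        · intro h'
          exact huv (σ.injective (h'.trans h.symm))
      refine ⟨isCycle_cycleOf σ hu, ?_⟩
      rcases hσ with h | h
      · left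
        rw [cycleOf_apply_self, h]
      · right
        have hs : σ.SameCycle u v := by
          rw [← h]
          exact (SameCycle.refl σ v).apply_left
        rw [hs.cycleOf_apply, h]
  rw [key, Matrix.det_apply', Matrix.det_apply',
    ← Finset.sum_filter_add_sum_filter_not Finset.univ (fun σ : Perm W => σ u = v ∨ σ v = u), add_comm]
  congr 1
  rw [← Finset.sum_filter_add_sum_filter_not Finset.univ (fun σ : Perm W => σ u = v ∨ σ v = u)
    (fun σ => ((sign σ : ℤ) : R) * ∏ i, M' (σ i) i)]
  have hz : ∑ σ : Perm W with (σ u = v ∨ σ v = u), ((sign σ : ℤ) : R) * ∏ i, M' (σ i) i = 0 := by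
    apply Finset.sum_eq_zero
    intro σ hσ
    simp only [Finset.mem_filter, Finset.mem_univ, true_and] at hσ
    rcases hσ with h | h
    · rw [Finset.prod_eq_zero (Finset.mem_univ u) (by rw [h, h2]), mul_zero]
    · rw [Finset.prod_eq_zero (Finset.mem_univ v) (by rw [h, h1]), mul_zero]
  rw [hz, zero_add]
  apply Finset.sum_congr rfl
  intro σ hσ
  simp only [Finset.mem_filter, Finset.mem_univ, true_and, not_or] at hσ
  congr 1
  apply Finset.prod_congr rfl
  intro i _
  apply h3
  · rintro ⟨ha, rfl⟩
    exact hσ.2 ha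
  · rintro ⟨ha, rfl⟩
    exact hσ.1 ha

/-- Cyclic permutations along edges of `G`, through the edge `uv` -/
def goodPerm {W : Type*} (G : SimpleGraph W) (u v : W) (c : Equiv.Perm W) : Prop :=
  c.IsCycle ∧ (c u = v ∨ c v = u) ∧ ∀ i, c i ≠ i → G.Adj (c i) i

open Equiv Equiv.Perm in
theorem aux_phi {W : Type*} [Fintype W] [DecidableEq W]
    (G : SimpleGraph W) [DecidableRel G.Adj] (u v : W) (he : G.Adj u v) :
    phi (G.adjMatrix (Polynomial ℤ)) =
      phi ((G.deleteEdges {s(u, v)}).adjMatrix (Polynomial ℤ))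
        - ∑ c : Perm W with goodPerm G u v c,
            phi (delSub (G.adjMatrix (Polynomial ℤ)) (c.support : Set W)) := by
  have huv := he.ne
  unfold phi
  rw [aux_det _ ((Polynomial.X : Polynomial ℤ) • (1 : Matrix W W (Polynomial ℤ)) -
    (G.deleteEdges {s(u, v)}).adjMatrix (Polynomial ℤ)) u v huv, sub_eq_add_neg]
  · congr 1
    rw [← Finset.sum_neg_distrib]
    have hsub : (Finset.univ.filter fun c : Perm W => goodPerm G u v c) ⊆
      (Finset.univ.filter fun c : Perm W => c.IsCycle ∧ (c u = v ∨ c v = u)) := by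
      intro c
      simp only [Finset.mem_filter, Finset.mem_univ, true_and]
      exact fun h => ⟨h.1, h.2.1⟩
    rw [← Finset.sum_subset hsub]
    · apply Finset.sum_congr rfl
      intro c hc
      simp only [Finset.mem_filter, Finset.mem_univ, true_and] at hc
      have hprod : ∏ i ∈ c.support, ((Polynomial.X : Polynomial ℤ) • (1 : Matrix W W (Polynomial ℤ)) -
          G.adjMatrix (Polynomial ℤ)) (c i) i = (-1) ^ c.support.card := by
        rw [← Finset.prod_const]
        apply Finset.prod_congr rfl
        intro i hi
        rw [mem_support] at hi
        simp [hi, hc.2.2 i hi]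
      rw [hprod, hc.1.sign]
      have hmat : delSub ((Polynomial.X : Polynomial ℤ) • (1 : Matrix W W (Polynomial ℤ)) -
          G.adjMatrix (Polynomial ℤ)) (c.support : Set W) =
          (Polynomial.X : Polynomial ℤ) • 1 - delSub (G.adjMatrix (Polynomial ℤ)) (c.support : Set W) := by
        ext i j
        simp [delSub, Matrix.one_apply, Subtype.ext_iff]
      rw [hmat]
      have hs : ((((-(-1) ^ c.support.card : ℤˣ)) : ℤ) : Polynomial ℤ) * (-1) ^ c.support.card = -1 := by
        push_cast
        rw [neg_mul, ← mul_pow]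
        simp
      rw [hs]
      ring
    · intro c hc hc'
      simp only [Finset.mem_filter, Finset.mem_univ, true_and] at hc hc'
      have : ∃ i, c i ≠ i ∧ ¬ G.Adj (c i) i := by
        by_contra hcon
        push Not at hcon
        exact hc' ⟨hc.1, hc.2, hcon⟩
      obtain ⟨i, hi, hi'⟩ := this
      rw [Finset.prod_eq_zero (mem_support.2 hi)]
      · simp
      · simp [hi, hi']
  · simp [huv]
  · simp [huv.symm]
  · intro i j h1 h2
    simp only [Matrix.sub_apply, SimpleGraph.adjMatrix_apply, SimpleGraph.deleteEdges_adj,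
      Set.mem_singleton_iff, Sym2.eq_iff]
    congr 2
    have : ¬ (i = u ∧ j = v ∨ i = v ∧ j = u) := by tauto
    simp [this]

/-- The subgraph of a cyclic permutation along edges. -/
def permSub {W : Type*} (G : SimpleGraph W) (c : Equiv.Perm W) (hc : ∀ i, c i ≠ i → G.Adj (c i) i) :
    G.Subgraph where
  verts := {i | c i ≠ i}
  Adj i j := i ≠ j ∧ (c i = j ∨ c j = i)
  adj_sub := by
    rintro i j ⟨hij, h | h⟩
    · subst h
      exact (hc i (Ne.symm hij)).symm
    · subst h
      exact hc j hij
  edge_vert := by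
    rintro i j ⟨hij, h | h⟩
    · subst h
      exact Ne.symm hij
    · subst h
      intro h
      exact hij (c.injective h)
  symm := ⟨fun i j h => ⟨h.1.symm, h.2.symm⟩⟩

theorem sq_ne {W : Type*} [Finite W] [DecidableEq W] {u v : W} (huv : u ≠ v) {c : Equiv.Perm W}
    (hc : c.IsCycle) (h1 : c u = v) (h2 : c v ≠ u) (w : W) (hw : c w ≠ w) : c (c w) ≠ w := by
  intro h
  have h3 := hc.eq_swap_of_apply_apply_eq_self hw h
  have hu : c u ≠ u := by rw [h1]; exact huv.symm
  apply h2
  rw [← h1, h3]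
  simp

theorem permSub_isCycle {W : Type*} [Finite W] [DecidableEq W] (G : SimpleGraph W) {u v : W}
    (huv : u ≠ v)
    (c : Equiv.Perm W) (hc : ∀ i, c i ≠ i → G.Adj (c i) i)
    (hcy : c.IsCycle) (h1 : c u = v) (h2 : c v ≠ u) : IsCycleSub G (permSub G c hc) := by
  have hu : c u ≠ u := by rw [h1]; exact huv.symm
  have hpow : ∀ n : ℕ, (c ^ n) u ∈ (permSub G c hc).verts := by
    intro n h
    rw [← Equiv.Perm.mul_apply, ← pow_succ', pow_succ, Equiv.Perm.mul_apply] at h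
    exact hu ((c ^ n).injective h)
  have hreach : ∀ n : ℕ, (permSub G c hc).coe.Reachable ⟨u, hu⟩ ⟨(c ^ n) u, hpow n⟩ := by
    intro n
    induction n with
    | zero => exact SimpleGraph.Reachable.refl _
    | succ n ih =>
      refine ih.trans (SimpleGraph.Adj.reachable ?_)
      have := hpow n
      refine ⟨fun h => this ?_, Or.inl ?_⟩
      · rw [← Equiv.Perm.mul_apply, ← pow_succ']
        exact h.symm
      · change c ((c ^ n) u) = (c ^ (n + 1)) u
        rw [← Equiv.Perm.mul_apply, ← pow_succ']
  refine ⟨⟨?_⟩, ⟨u, hu⟩, ?_⟩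
  · rw [SimpleGraph.connected_iff_exists_forall_reachable]
    refine ⟨⟨u, hu⟩, ?_⟩
    rintro ⟨w, hw⟩
    obtain ⟨n, hn⟩ := hcy.exists_pow_eq hu hw
    subst hn
    exact hreach n
  · intro w hw
    have : (permSub G c hc).neighborSet w = {c w, c⁻¹ w} := by
      ext x
      have hw' : c w ≠ w := hw
      change (w ≠ x ∧ (c w = x ∨ c x = w)) ↔ (x = c w ∨ x = c⁻¹ w)
      rw [Equiv.Perm.eq_inv_iff_eq]
      constructor
      · rintro ⟨_, h | h⟩
        · exact Or.inl h.symm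
        · exact Or.inr h
      · rintro (h | h)
        · exact ⟨fun h' => hw' (by rw [← h, ← h']), Or.inl h.symm⟩
        · refine ⟨fun h' => hw' ?_, Or.inr h⟩
          subst h'
          exact h
    rw [this, Set.ncard_pair]
    intro h
    rw [Equiv.Perm.eq_inv_iff_eq] at h
    exact sq_ne huv hcy h1 h2 w hw h

theorem permSub_inj {W : Type*} [Finite W] [DecidableEq W] (G : SimpleGraph W) {u v : W}
    (huv : u ≠ v) (c d : Equiv.Perm W)
    (hc : ∀ i, c i ≠ i → G.Adj (c i) i) (hd : ∀ i, d i ≠ i → G.Adj (d i) i)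
    (hcy : c.IsCycle) (h1 : c u = v) (h2 : c v ≠ u)
    (hdy : d.IsCycle) (h1' : d u = v)
    (h : permSub G c hc = permSub G d hd) : c = d := by
  have hu : c u ≠ u := by rw [h1]; exact huv.symm
  have hv : ∀ i, c i ≠ i ↔ d i ≠ i := by
    intro i
    have : i ∈ (permSub G c hc).verts ↔ i ∈ (permSub G d hd).verts := by rw [h]
    exact this
  have hA : ∀ i j, (i ≠ j ∧ (c i = j ∨ c j = i)) → (i ≠ j ∧ (d i = j ∨ d j = i)) := by
    intro i j
    have : (permSub G c hc).Adj i j ↔ (permSub G d hd).Adj i j := by rw [h]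
    exact this.1
  have hpow : ∀ n : ℕ, c ((c ^ n) u) = d ((c ^ n) u) := by
    intro n
    induction n with
    | zero => simp [h1, h1']
    | succ n ih =>
      rw [pow_succ', Equiv.Perm.mul_apply]
      set w := (c ^ n) u with hw
      have hwm : c w ≠ w := by
        intro h
        rw [hw, ← Equiv.Perm.mul_apply, ← pow_succ', pow_succ, Equiv.Perm.mul_apply] at h
        exact hu ((c ^ n).injective h)
      have hsq := sq_ne huv hcy h1 h2 w hwm
      have := hA (c w) (c (c w)) ⟨fun h => hwm (c.injective h.symm), Or.inl rfl⟩
      rcases this.2 with h | h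
      · exact h.symm
      · exfalso
        rw [ih] at h
        have := d.injective h
        rw [← ih] at this
        exact hsq this
  ext w
  by_cases hw : c w = w
  · have : d w = w := by
      by_contra h'
      exact (hv w).2 h' hw
    rw [hw, this]
  · obtain ⟨n, rfl⟩ := hcy.exists_pow_eq hu hw
    exact hpow n

theorem permSub_surj {W : Type*} [Fintype W] [DecidableEq W] (G : SimpleGraph W) {u v : W}
    (C : G.Subgraph) (hC : IsCycleSub G C) (huv : C.Adj u v) :
    ∃ c : Equiv.Perm W, c.IsCycle ∧ c u = v ∧ c v ≠ u ∧
      ∃ hc : ∀ i, c i ≠ i → G.Adj (c i) i, permSub G c hc = C := by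
  obtain ⟨hconn, -, hdeg⟩ := hC
  have hcyc : C.spanningCoe.IsCycles := by
    rintro w ⟨x, hx⟩
    exact hdeg w (C.edge_vert hx)
  obtain ⟨p, hp, hpv⟩ := hcyc.exists_cycle_toSubgraph_verts_eq_connectedComponentSupp
    (c := C.spanningCoe.connectedComponentMk u) (v := u) rfl ⟨v, huv⟩
  -- support of the walk
  have hsupp : ∀ w, w ∈ p.support ↔ w ∈ C.verts := by
    intro w
    rw [← SimpleGraph.Walk.mem_verts_toSubgraph, hpv, SimpleGraph.ConnectedComponent.mem_supp_iff,
      SimpleGraph.ConnectedComponent.eq]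
    constructor
    · rintro ⟨q⟩
      cases q with
      | nil => exact C.edge_vert huv
      | cons h _ => exact C.edge_vert h
    · intro hw
      have hr := hconn.coe.preconnected ⟨w, hw⟩ ⟨u, C.edge_vert huv⟩
      exact hr.map (⟨Subtype.val, fun h => h⟩ : C.coe →g C.spanningCoe)
  set l := p.support.tail with hl
  have hnd : l.Nodup := hp.support_nodup
  have hlen : l.length = p.length := by simp [hl]
  have h3 : 3 ≤ l.length := by rw [hlen]; exact hp.three_le_length
  have hmem : ∀ w, w ∈ l ↔ w ∈ C.verts := by
    intro w
    rw [← hsupp]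
    constructor
    · exact fun h => List.mem_of_mem_tail h
    · intro h
      rw [SimpleGraph.Walk.mem_support_iff] at h
      rcases h with rfl | h
      · exact SimpleGraph.Walk.end_mem_tail_support hp.not_nil
      · exact h
  have hget : ∀ i (h : i < l.length), l[i] = p.getVert (i + 1) := by
    intro i h
    simp [hl, SimpleGraph.Walk.support_getElem_eq_getVert]
  have hstep : ∀ w ∈ l, C.Adj w (l.formPerm w) ∧ l.formPerm (l.formPerm w) ≠ w := by
    intro w hw
    obtain ⟨i, hi, rfl⟩ := List.getElem_of_mem hw
    constructor
    · rw [List.formPerm_apply_getElem _ hnd, hget, hget]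
      rcases Nat.lt_or_ge (i + 1) l.length with h | h
      · rw [Nat.mod_eq_of_lt h]
        exact p.adj_getVert_succ (by omega)
      · have : i + 1 = l.length := by omega
        rw [this, Nat.mod_self, hlen, SimpleGraph.Walk.getVert_length]
        have := p.adj_getVert_succ (i := 0) (by omega)
        rwa [SimpleGraph.Walk.getVert_zero] at this
    · rw [List.formPerm_apply_getElem _ hnd, List.formPerm_apply_getElem _ hnd, Ne, hnd.getElem_inj_iff]
      rcases Nat.lt_or_ge (i + 1) l.length with h | h
      · rw [Nat.mod_eq_of_lt h]
        rcases Nat.lt_or_ge (i + 1 + 1) l.length with h' | h'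
        · rw [Nat.mod_eq_of_lt h']
          omega
        · have : i + 1 + 1 = l.length := by omega
          rw [this, Nat.mod_self]
          omega
      · have : i + 1 = l.length := by omega
        rw [this, Nat.mod_self, Nat.mod_eq_of_lt (by omega)]
        omega
  set d := l.formPerm with hd
  have hdc : d.IsCycle := List.isCycle_formPerm hnd (by omega)
  have hfix : ∀ w, d w ≠ w → w ∈ l := fun w h => List.mem_of_formPerm_apply_ne h
  have main : ∀ c : Equiv.Perm W, (∀ w, c w ≠ w ↔ w ∈ C.verts) → (∀ w, c w ≠ w → C.Adj w (c w)) →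
      (∀ w, c w ≠ w → c (c w) ≠ w) →
      ∃ hc : ∀ i, c i ≠ i → G.Adj (c i) i, permSub G c hc = C := by
    intro c hv ha hs
    refine ⟨fun i hi => (C.adj_sub (ha i hi)).symm, ?_⟩
    have hle : ∀ i j, (i ≠ j ∧ (c i = j ∨ c j = i)) → C.Adj i j := by
      rintro i j ⟨hij, h | h⟩
      · rw [← h]
        exact ha i (by rw [h]; exact hij.symm)
      · have := ha j (by rw [h]; exact hij)
        rw [h] at this
        exact this.symm
    have hns : ∀ w, w ∈ C.verts → C.neighborSet w = {c w, c⁻¹ w} := by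
      intro w hw
      symm
      have hw' := (hv w).2 hw
      have hi : c⁻¹ w ≠ w := fun h => hw' (by rw [Equiv.Perm.inv_eq_iff_eq] at h; exact h.symm)
      apply Set.eq_of_subset_of_ncard_le
      · rintro x (rfl | rfl)
        · exact ha w hw'
        · exact hle _ _ ⟨hi.symm, Or.inr (by simp)⟩
      · rw [hdeg w hw, Set.ncard_pair]
        intro h
        rw [Equiv.Perm.eq_inv_iff_eq] at h
        exact hs w hw' h
      · exact Set.toFinite _
    ext i j
    · exact hv i
    · constructor
      · exact hle i j
      · intro h
        have hj : j ∈ C.neighborSet i := h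
        rw [hns i (C.edge_vert h)] at hj
        refine ⟨h.ne, ?_⟩
        rcases hj with rfl | rfl
        · exact Or.inl rfl
        · right; simp
  have hdv : ∀ w, d w ≠ w ↔ w ∈ C.verts := by
    intro w
    rw [← hmem]
    exact ⟨hfix w, fun h => (C.adj_sub (hstep w h).1).ne'⟩
  have hda : ∀ w, d w ≠ w → C.Adj w (d w) := fun w h => (hstep w (hfix w h)).1
  have hds : ∀ w, d w ≠ w → d (d w) ≠ w := fun w h => (hstep w (hfix w h)).2
  obtain ⟨hG, hE⟩ := main d hdv hda hds
  have hor : d u = v ∨ d v = u := by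
    rw [← hE] at huv
    exact huv.2
  have hdu : d u ≠ u := (hdv u).2 (C.edge_vert huv)
  have hdvv : d v ≠ v := (hdv v).2 (C.edge_vert huv.symm)
  rcases hor with h | h
  · refine ⟨d, hdc, h, ?_, hG, hE⟩
    rw [← h]
    exact hds u hdu
  · have hinv : ∀ w, d⁻¹ w ≠ w ↔ d w ≠ w := by
      intro w
      rw [Ne, Equiv.Perm.inv_eq_iff_eq, eq_comm]
    refine ⟨d⁻¹, hdc.inv, ?_, ?_, main d⁻¹ ?_ ?_ ?_⟩
    · rw [Equiv.Perm.inv_eq_iff_eq, h]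
    · rw [Ne, Equiv.Perm.inv_eq_iff_eq, ← h]
      exact (hds v hdvv).symm
    · intro w
      rw [hinv, hdv]
    · intro w hw
      have h' := hda (d⁻¹ w) (by simpa using hw.symm)
      simpa using h'.symm
    · intro w hw
      rw [Ne, Equiv.Perm.inv_eq_iff_eq, Equiv.Perm.inv_eq_iff_eq]
      exact (hds w ((hinv w).1 hw)).symm

theorem phi_congr {W : Type*} (A : Matrix W W (Polynomial ℤ)) (S T : Set W) (h : S = T)
    {i1 : Fintype {w : W // w ∉ S}} {d1 : DecidableEq {w : W // w ∉ S}}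
    {i2 : Fintype {w : W // w ∉ T}} {d2 : DecidableEq {w : W // w ∉ T}} :
    @phi _ _ i1 d1 _ (delSub A S) = @phi _ _ i2 d2 _ (delSub A T) := by
  subst h
  obtain rfl := Subsingleton.elim i1 i2
  obtain rfl := Subsingleton.elim d1 d2
  rfl

theorem adjacency_charpoly_edge_recursion
    {V : Type*} [Fintype V] [DecidableEq V]
    (G : SimpleGraph V) [DecidableRel G.Adj] (u v : V) (he : G.Adj u v) :
    phi (G.adjMatrix (Polynomial ℤ)) =
      phi ((G.deleteEdges {s(u, v)}).adjMatrix (Polynomial ℤ))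
        - phi (delSub (G.adjMatrix (Polynomial ℤ)) {u, v})
        - 2 * ∑ᶠ C ∈ {C : G.Subgraph | IsCycleSub G C ∧ C.Adj u v},
          phi (delSub (G.adjMatrix (Polynomial ℤ)) C.verts) := by

  have huv := he.ne
  set F : Equiv.Perm V → Polynomial ℤ := fun c =>
    phi (delSub (G.adjMatrix (Polynomial ℤ)) (c.support : Set V)) with hF
  set P1 : Finset (Equiv.Perm V) := Finset.univ.filter fun c =>
    goodPerm G u v c ∧ c u = v ∧ c v ≠ u with hP1
  set P2 : Finset (Equiv.Perm V) := Finset.univ.filter fun c =>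
    goodPerm G u v c ∧ c v = u ∧ c u ≠ v with hP2
  have hsplit : (Finset.univ.filter fun c : Equiv.Perm V => goodPerm G u v c) =
      insert (Equiv.swap u v) (P1 ∪ P2) := by
    ext c
    simp only [hP1, hP2, Finset.mem_filter, Finset.mem_univ, true_and, Finset.mem_insert,
      Finset.mem_union]
    constructor
    · intro h
      by_cases h1 : c u = v
      · by_cases h2 : c v = u
        · left
          have := h.1.eq_swap_of_apply_apply_eq_self (x := u) (by rw [h1]; exact huv.symm)
            (by rw [h1, h2])
          rwa [h1] at this
        · exact Or.inr (Or.inl ⟨h, h1, h2⟩)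
      · have h2 : c v = u := h.2.1.resolve_left h1
        exact Or.inr (Or.inr ⟨h, h2, h1⟩)
    · rintro (rfl | h | h)
      · refine ⟨Equiv.Perm.isCycle_swap huv, Or.inl (Equiv.swap_apply_left u v), ?_⟩
        intro i hi
        rcases (Equiv.swap_apply_ne_self_iff.1 hi).2 with rfl | rfl
        · rw [Equiv.swap_apply_left]; exact he.symm
        · rw [Equiv.swap_apply_right]; exact he
      · exact h.1
      · exact h.1
  have hnot : Equiv.swap u v ∉ P1 ∪ P2 := by
    simp [hP1, hP2]
  have hdis : Disjoint P1 P2 := by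
    rw [Finset.disjoint_left]
    intro c h1 h2
    simp only [hP1, hP2, Finset.mem_filter, Finset.mem_univ, true_and] at h1 h2
    exact h2.2.2 h1.2.1
  have hinvgood : ∀ c, goodPerm G u v c → goodPerm G u v c⁻¹ := by
    rintro c ⟨h1, h2, h3⟩
    refine ⟨h1.inv, ?_, ?_⟩
    · rcases h2 with h | h
      · right; rw [Equiv.Perm.inv_eq_iff_eq, h]
      · left; rw [Equiv.Perm.inv_eq_iff_eq, h]
    · intro i hi
      have := h3 (c⁻¹ i) (by simpa using hi.symm)
      simpa using this.symm
  have h12 : ∑ c ∈ P2, F c = ∑ c ∈ P1, F c := by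
    refine Finset.sum_bij (fun c _ => c⁻¹) ?_ ?_ ?_ ?_
    · intro c hc
      simp only [hP1, hP2, Finset.mem_filter, Finset.mem_univ, true_and] at hc ⊢
      refine ⟨hinvgood c hc.1, ?_, ?_⟩
      · rw [Equiv.Perm.inv_eq_iff_eq, hc.2.1]
      · rw [Ne, Equiv.Perm.inv_eq_iff_eq]
        exact fun h => hc.2.2 h.symm
    · intro a _ b _ h
      exact inv_injective h
    · intro c hc
      simp only [hP1, hP2, Finset.mem_filter, Finset.mem_univ, true_and] at hc
      refine ⟨c⁻¹, ?_, inv_inv c⟩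
      simp only [hP2, Finset.mem_filter, Finset.mem_univ, true_and]
      refine ⟨hinvgood c hc.1, ?_, ?_⟩
      · rw [Equiv.Perm.inv_eq_iff_eq, hc.2.1]
      · rw [Ne, Equiv.Perm.inv_eq_iff_eq]
        exact fun h => hc.2.2 h.symm
    · intro c _
      apply phi_congr
      rw [Equiv.Perm.support_inv]
  have hswap : F (Equiv.swap u v) = phi (delSub (G.adjMatrix (Polynomial ℤ)) {u, v}) := by
    have hset : (((Equiv.swap u v).support : Finset V) : Set V) = {u, v} := by
      rw [Equiv.Perm.support_swap huv]
      simp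
    exact phi_congr _ _ _ hset
  have hbij : ∑ᶠ C ∈ {C : G.Subgraph | IsCycleSub G C ∧ C.Adj u v},
      phi (delSub (G.adjMatrix (Polynomial ℤ)) C.verts) = ∑ c ∈ P1, F c := by
    rw [← finsum_mem_coe_finset]
    symm
    have hmem : ∀ c, c ∈ (P1 : Set (Equiv.Perm V)) ↔ goodPerm G u v c ∧ c u = v ∧ c v ≠ u := by
      intro c
      simp [hP1]
    refine finsum_mem_eq_of_bijOn (fun c => if hc : ∀ i, c i ≠ i → G.Adj (c i) i then
      permSub G c hc else ⊥) ⟨?_, ?_, ?_⟩ ?_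
    · intro c hc
      rw [hmem] at hc
      have hg := hc.1.2.2
      simp only [dif_pos hg]
      exact ⟨permSub_isCycle G huv c hg hc.1.1 hc.2.1 hc.2.2, huv, Or.inl hc.2.1⟩
    · intro c hc d hd h
      rw [hmem] at hc hd
      have hg := hc.1.2.2
      have hg' := hd.1.2.2
      simp only [dif_pos hg, dif_pos hg'] at h
      exact permSub_inj G huv c d hg hg' hc.1.1 hc.2.1 hc.2.2 hd.1.1 hd.2.1 h
    · rintro C ⟨hC, hadj⟩
      obtain ⟨c, h1, h2, h3, hg, h4⟩ := permSub_surj G C hC hadj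
      refine ⟨c, ?_, ?_⟩
      · rw [hmem]
        exact ⟨⟨h1, Or.inl h2, hg⟩, h2, h3⟩
      · simp only [dif_pos hg]
        exact h4
    · intro c hc
      rw [hmem] at hc
      have hg := hc.1.2.2
      apply phi_congr
      rw [dif_pos hg]
      ext i
      simp [permSub]
  have haux : phi (G.adjMatrix (Polynomial ℤ)) =
      phi ((G.deleteEdges {s(u, v)}).adjMatrix (Polynomial ℤ))
        - ∑ c : Equiv.Perm V with goodPerm G u v c, F c := aux_phi G u v he
  rw [haux, hbij, hsplit, Finset.sum_insert hnot, Finset.sum_union hdis, h12, hswap]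
  ring
end
end

section
/- Let G be a simple graph on a finite vertex type, let α be a real number with 0 ≤ α ≤ 1, let A_α(G) = α·D(G) + (1 − α)·A(G), and let v be a vertex of G. Then the characteristic polynomial satisfies φ(A_α(G)) = (x − α·d(v))·φ((A_α)_v(G)) − (1 − α)²·Σ_{u ∈ N(v)} φ((A_α)_{uv}(G)) − 2·Σ_{C ∈ 𝔠_G(v)} (1 − α)^{|V(C)|}·φ((A_α)_{V(C)}(G)). -/
open Polynomial Matrix

attribute [local instance] Classical.propDecidable

noncomputable section

variable {V : Type*}

variable [Fintype V] [DecidableEq V]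

/-- The matrix `A_α(G) = α·D(G) + (1-α)·A(G)` over `ℝ[x]`. -/
def aAlpha (α : ℝ) (G : SimpleGraph V) [DecidableRel G.Adj] :
    Matrix V V (Polynomial ℝ) :=
  Polynomial.C α • degMat (Polynomial ℝ) G + Polynomial.C (1 - α) • G.adjMatrix (Polynomial ℝ)

theorem fiber_sum {R : Type*} [CommRing R] (M : Matrix V V R) (v : V) (c : Equiv.Perm V)
    (hc : c.cycleOf v = c) :
    ∑ σ : Equiv.Perm V with σ.cycleOf v = c, Equiv.Perm.sign σ • ∏ i, M (σ i) i =
      (Equiv.Perm.sign c • ∏ i ∈ insert v c.support, M (c i) i) *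
        (delSub M ((insert v c.support : Finset V) : Set V)).det := by
  rw [Matrix.det_apply, Finset.mul_sum]
  symm
  have hdis : ∀ τ : Equiv.Perm {w : V // w ∉ ((insert v c.support : Finset V) : Set V)},
      c.Disjoint (Equiv.Perm.ofSubtype τ) := by
    intro τ w
    by_cases h : w ∈ insert v c.support
    · right
      exact Equiv.Perm.ofSubtype_apply_of_not_mem τ (fun hh => hh (Finset.mem_coe.2 h))
    · left
      simp at h
      tauto
  refine Finset.sum_bij (fun τ _ => c * Equiv.Perm.ofSubtype τ) ?_ ?_ ?_ ?_
  · intro τ _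
    simp only [Finset.mem_filter, Finset.mem_univ, true_and]
    rw [Equiv.Perm.cycleOf_mul_of_apply_right_eq_self (hdis τ).commute, hc]
    exact Equiv.Perm.ofSubtype_apply_of_not_mem τ (by simp)
  · intro a _ b _ h
    exact Equiv.Perm.ofSubtype_injective (mul_left_cancel h)
  · intro σ hσ
    simp only [Finset.mem_filter, Finset.mem_univ, true_and] at hσ
    have key : ∀ w, w ∈ insert v c.support → c w = σ w := by
      intro w hw
      rw [Finset.mem_insert] at hw
      rcases hw with rfl | hw
      · rw [← hσ, Equiv.Perm.cycleOf_apply_self]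
      · rw [← hσ] at hw ⊢
        rw [Equiv.Perm.mem_support_cycleOf_iff] at hw
        exact hw.1.cycleOf_apply
    obtain ⟨τ, hτ⟩ := (Equiv.Perm.subtypeEquivSubtypePerm
      (fun w : V => w ∉ ((insert v c.support : Finset V) : Set V))).surjective
      ⟨c⁻¹ * σ, by
        intro a ha
        have ha' : a ∈ insert v c.support := Finset.mem_coe.1 (not_not.1 ha)
        rw [Equiv.Perm.mul_apply, ← key a ha']; simp⟩
    refine ⟨τ, Finset.mem_univ _, ?_⟩
    have h2 : Equiv.Perm.ofSubtype τ = c⁻¹ * σ := congrArg Subtype.val hτ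
    rw [h2]; simp
  · intro τ _
    rw [map_mul, Equiv.Perm.sign_ofSubtype, ← Finset.prod_mul_prod_compl (insert v c.support)]
    have e1 : ∏ i ∈ insert v c.support, M ((c * Equiv.Perm.ofSubtype τ) i) i
        = ∏ i ∈ insert v c.support, M (c i) i := by
      refine Finset.prod_congr rfl fun i hi => ?_
      rw [Equiv.Perm.mul_apply, Equiv.Perm.ofSubtype_apply_of_not_mem τ (fun hh => hh (Finset.mem_coe.2 hi))]
    have e2 : ∏ i ∈ (insert v c.support)ᶜ, M ((c * Equiv.Perm.ofSubtype τ) i) i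
        = ∏ i, delSub M ((insert v c.support : Finset V) : Set V) (τ i) i := by
      rw [Finset.prod_subtype (p := fun w => w ∉ ((insert v c.support : Finset V) : Set V)) _
        (by intro x; simp)]
      refine Finset.prod_congr rfl fun i _ => ?_
      rw [Equiv.Perm.mul_apply, Equiv.Perm.ofSubtype_apply_coe]
      have h3 := (τ i).2
      have h4 : c (τ i) = τ i := by
        simp at h3; tauto
      rw [h4]; rfl
    rw [e1, e2, smul_mul_smul_comm]

theorem det_expand {R : Type*} [CommRing R] (M : Matrix V V R) (v : V) :
    M.det = ∑ c : Equiv.Perm V with c.cycleOf v = c,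
      (Equiv.Perm.sign c • ∏ i ∈ insert v c.support, M (c i) i) *
        (delSub M ((insert v c.support : Finset V) : Set V)).det := by
  rw [Matrix.det_apply, ← Finset.sum_fiberwise_of_maps_to (s := Finset.univ)
    (t := Finset.univ.filter fun c : Equiv.Perm V => c.cycleOf v = c)
    (g := fun σ => σ.cycleOf v)]
  · refine Finset.sum_congr rfl fun c hc => fiber_sum M v c ?_
    simpa using hc
  · intro σ _
    simp only [Finset.mem_filter, Finset.mem_univ, true_and]
    by_cases h : σ v = v
    · rw [(Equiv.Perm.cycleOf_eq_one_iff σ).2 h, Equiv.Perm.cycleOf_one]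
    · exact (Equiv.Perm.isCycle_cycleOf σ h).cycleOf_eq (by simpa using h)

/-- The determinant of the principal submatrix of `M` avoiding `S`. -/
def dd {R : Type*} [CommRing R] (M : Matrix V V R) (S : Set V) : R := (delSub M S).det

theorem phi_delSub {R : Type*} [CommRing R] (A : Matrix V V (Polynomial R)) (S : Set V)
    [i1 : Fintype {w : V // w ∉ S}] [i2 : DecidableEq {w : V // w ∉ S}] :
    @phi _ R i1 i2 _ (delSub A S) =
      dd ((Polynomial.X : Polynomial R) • (1 : Matrix V V (Polynomial R)) - A) S := by
  unfold phi dd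
  have e : (Polynomial.X : Polynomial R) • (1 : Matrix _ _ (Polynomial R)) - delSub A S =
      delSub ((Polynomial.X : Polynomial R) • (1 : Matrix V V (Polynomial R)) - A) S := by
    ext i j
    simp [delSub, Matrix.one_apply, Subtype.ext_iff]
  rw [e]
  convert rfl

theorem det_expand' {R : Type*} [CommRing R] (M : Matrix V V R) (v : V) :
    M.det = ∑ c : Equiv.Perm V with c.cycleOf v = c,
      (Equiv.Perm.sign c • ∏ i ∈ insert v c.support, M (c i) i) *
        dd M ((insert v c.support : Finset V) : Set V) := by
  rw [det_expand M v]
  refine Finset.sum_congr rfl fun c _ => ?_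
  congr 1
  unfold dd
  convert rfl

/-- The subgraph of `G` traced by the permutation `c`. -/
def cycSub (G : SimpleGraph V) (c : Equiv.Perm V) : G.Subgraph where
  verts := {w | c w ≠ w}
  Adj a b := G.Adj a b ∧ (c a = b ∨ c b = a)
  adj_sub h := h.1
  edge_vert := by
    rintro a b ⟨h, h1 | h1⟩ h2
    · exact h.ne (h2.symm.trans h1)
    · exact h.ne (c.injective (h2.trans h1.symm))
  symm := ⟨fun a b h => ⟨h.1.symm, h.2.symm⟩⟩

/-- `c` is an oriented cycle of `G` through `v`. -/
def GoodCyc (G : SimpleGraph V) (v : V) (c : Equiv.Perm V) : Prop :=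
  c.IsCycle ∧ c v ≠ v ∧ 3 ≤ c.support.card ∧ ∀ w, c w ≠ w → G.Adj (c w) w

theorem GoodCyc.inv {G : SimpleGraph V} {v : V} {c : Equiv.Perm V} (h : GoodCyc G v c) :
    GoodCyc G v c⁻¹ := by
  obtain ⟨h1, h2, h3, h4⟩ := h
  refine ⟨h1.inv, ?_, by simpa using h3, ?_⟩
  · intro h; apply h2; rw [Equiv.Perm.inv_eq_iff_eq] at h; exact h.symm
  · intro w hw
    have := h4 (c⁻¹ w) (by simpa using fun h => hw h.symm)
    simpa using this.symm

theorem cycSub_inv (G : SimpleGraph V) (c : Equiv.Perm V) : cycSub G c⁻¹ = cycSub G c := by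
  ext a b
  · change ¬ (c⁻¹ a = a) ↔ ¬ (c a = a)
    rw [Equiv.Perm.inv_eq_iff_eq, eq_comm]
  · simp only [cycSub, Equiv.Perm.inv_eq_iff_eq]
    constructor <;> rintro ⟨h, h' | h'⟩ <;> simp_all

theorem no_two {c : Equiv.Perm V} (h1 : c.IsCycle) (h3 : 3 ≤ c.support.card) (w : V)
    (hw : c w ≠ w) : c (c w) ≠ w := by
  intro h
  have h5 : c ^ 2 = 1 := h1.pow_eq_one_iff.2 ⟨w, hw, by simpa [pow_two] using h⟩
  have h6 := Nat.le_of_dvd (by norm_num) (orderOf_dvd_of_pow_eq_one h5)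
  rw [h1.orderOf] at h6
  omega

theorem GoodCyc.isCycleSub {G : SimpleGraph V} {v : V} {c : Equiv.Perm V} (h : GoodCyc G v c) :
    IsCycleSub G (cycSub G c) := by
  obtain ⟨h1, h2, h3, h4⟩ := h
  have hpow : ∀ n : ℕ, (c ^ n) v ∈ (cycSub G c).verts := by
    intro n hn
    apply h2
    rw [← Equiv.Perm.mul_apply, ← pow_succ', pow_succ, Equiv.Perm.mul_apply] at hn
    exact (c ^ n).injective hn
  refine ⟨?_, ⟨v, h2⟩, ?_⟩
  · rw [SimpleGraph.Subgraph.connected_iff']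
    rw [SimpleGraph.connected_iff_exists_forall_reachable]
    have hr : ∀ n : ℕ, (cycSub G c).coe.Reachable ⟨v, h2⟩ ⟨(c ^ n) v, hpow n⟩ := by
      intro n
      induction n with
      | zero => exact SimpleGraph.Reachable.refl _
      | succ n ih =>
        refine ih.trans (SimpleGraph.Adj.reachable ?_)
        have e : (c ^ (n + 1)) v = c ((c ^ n) v) := by rw [pow_succ', Equiv.Perm.mul_apply]
        change G.Adj _ _ ∧ _
        simp only [e]
        exact ⟨(h4 _ (hpow n)).symm, Or.inl (by trivial)⟩
    refine ⟨⟨v, h2⟩, ?_⟩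
    rintro ⟨w, hw⟩
    obtain ⟨n, rfl⟩ := h1.exists_pow_eq h2 hw
    exact hr n
  · intro w hw
    have e : (cycSub G c).neighborSet w = {c w, c⁻¹ w} := by
      ext x
      simp only [SimpleGraph.Subgraph.mem_neighborSet, cycSub, Set.mem_insert_iff,
        Set.mem_singleton_iff]
      constructor
      · rintro ⟨_, h | h⟩
        · exact Or.inl h.symm
        · right; rw [← h]; simp
      · rintro (rfl | rfl)
        · exact ⟨(h4 w hw).symm, Or.inl rfl⟩
        · refine ⟨?_, Or.inr (by simp)⟩
          have := h4 (c⁻¹ w) (by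
            intro h; apply hw
            have h' := congrArg c h
            simpa using h')
          simpa using this
    rw [e, Set.ncard_pair]
    intro h
    apply no_two h1 h3 w hw
    rw [h]; simp

theorem GoodCyc.uniq {G : SimpleGraph V} {v : V} {c d : Equiv.Perm V} (h : GoodCyc G v c)
    (hcd : cycSub G c = cycSub G d) (hv : c v = d v) : c = d := by
  obtain ⟨h1, h2, h3, h4⟩ := h
  have hvert : ∀ w, c w ≠ w ↔ d w ≠ w := fun w => by
    have := congrArg (fun C => w ∈ C.verts) hcd
    exact iff_of_eq this
  have hadj : ∀ w, c w ≠ w → d w = c w ∨ d (c w) = w := fun w hw => by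
    have h5 : (cycSub G c).Adj w (c w) := ⟨(h4 w hw).symm, Or.inl rfl⟩
    rw [hcd] at h5
    exact h5.2
  have hpow : ∀ n : ℕ, c ((c ^ n) v) ≠ (c ^ n) v := by
    intro n hn
    apply h2
    rw [← Equiv.Perm.mul_apply, ← pow_succ', pow_succ, Equiv.Perm.mul_apply] at hn
    exact (c ^ n).injective hn
  have key : ∀ n : ℕ, (c ^ n) v = (d ^ n) v ∧ c ((c ^ n) v) = d ((d ^ n) v) := by
    intro n
    induction n with
    | zero => exact ⟨rfl, hv⟩
    | succ n ih =>
      obtain ⟨i1, i2⟩ := ih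
      have hn := hpow n
      have hn1 := hpow (n + 1)
      rw [pow_succ', Equiv.Perm.mul_apply] at hn1
      rw [pow_succ', pow_succ', Equiv.Perm.mul_apply, Equiv.Perm.mul_apply]
      refine ⟨i2, ?_⟩
      rw [← i2]
      rcases hadj _ hn1 with h | h
      · exact h.symm
      · exfalso
        rw [i2] at h
        have h6 := d.injective h
        rw [← i2, ← i1] at h6
        exact no_two h1 h3 _ hn h6
  ext w
  by_cases hw : c w = w
  · rw [hw]
    by_contra h
    exact (hvert w).2 (fun h' => h h'.symm) hw
  · obtain ⟨n, rfl⟩ := h1.exists_pow_eq h2 hw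
    rw [(key n).2, (key n).1]

theorem GoodCyc.fiber {G : SimpleGraph V} {v : V} {c d : Equiv.Perm V} (h : GoodCyc G v c)
    (h' : GoodCyc G v d) (hcd : cycSub G c = cycSub G d) : d = c ∨ d = c⁻¹ := by
  have h5 : (cycSub G d).Adj v (d v) := ⟨(h'.2.2.2 v h'.2.1).symm, Or.inl rfl⟩
  rw [← hcd] at h5
  rcases h5.2 with h6 | h6
  · left; exact (h.uniq hcd h6).symm
  · right
    refine (h.inv.uniq (by rw [cycSub_inv, hcd]) ?_).symm
    rw [Equiv.Perm.inv_eq_iff_eq, h6]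

theorem GoodCyc.ne_inv {G : SimpleGraph V} {v : V} {c : Equiv.Perm V} (h : GoodCyc G v c) :
    c ≠ c⁻¹ := by
  intro h'
  apply no_two h.1 h.2.2.1 v h.2.1
  nth_rewrite 1 [h']
  simp

theorem exists_good {G : SimpleGraph V} {v : V} {C : G.Subgraph} (h : IsCycleSub G C)
    (hv : v ∈ C.verts) : ∃ c, GoodCyc G v c ∧ cycSub G c = C := by
  obtain ⟨hcon, -, hdeg⟩ := h
  have hdeg' : ∀ w : C.verts, (C.coe.neighborSet w).ncard = 2 := by
    intro w
    rw [← hdeg w w.2, ← Set.ncard_image_of_injective _ Subtype.val_injective]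
    congr 1
    ext x
    simp only [Set.mem_image, SimpleGraph.mem_neighborSet, SimpleGraph.Subgraph.mem_neighborSet]
    constructor
    · rintro ⟨y, hy, rfl⟩; exact hy
    · intro hx; exact ⟨⟨x, hx.snd_mem⟩, hx, rfl⟩
  have hcyc : C.coe.IsCycles := fun w _ => hdeg' w
  obtain ⟨p, hp, hpv⟩ := hcyc.exists_cycle_toSubgraph_verts_eq_connectedComponentSupp
    (v := ⟨v, hv⟩) (c := C.coe.connectedComponentMk ⟨v, hv⟩) rfl
    (Set.nonempty_of_ncard_ne_zero (by rw [hdeg']; norm_num))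
  have hsupp : ∀ w, w ∈ p.support := by
    intro w
    rw [← SimpleGraph.Walk.mem_verts_toSubgraph, hpv]
    rw [SimpleGraph.Subgraph.connected_iff'] at hcon
    exact SimpleGraph.ConnectedComponent.sound (hcon.preconnected _ _)
  have hlen := hp.three_le_length
  set l : List V := p.support.tail.map Subtype.val with hl
  have hnd : l.Nodup := hp.support_nodup.map Subtype.val_injective
  have hll : l.length = p.length := by simp [hl]
  have hmem : ∀ w, w ∈ l ↔ w ∈ C.verts := by
    intro w
    rw [hl, List.mem_map]
    constructor
    · rintro ⟨y, _, rfl⟩; exact y.2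
    · intro hw
      refine ⟨⟨w, hw⟩, ?_, rfl⟩
      have h1 := hsupp ⟨w, hw⟩
      rw [SimpleGraph.Walk.mem_support_iff] at h1
      rcases h1 with h1 | h1
      · rw [h1]; exact SimpleGraph.Walk.end_mem_tail_support hp.not_nil
      · exact h1
  have hget : ∀ i (hi : i < l.length), l[i] = (p.getVert (i + 1) : V) := by
    intro i hi
    simp only [hl, List.getElem_map, List.getElem_tail, SimpleGraph.Walk.support_getElem_eq_getVert]
  have hadj : ∀ w ∈ C.verts, C.Adj w (l.formPerm w) := by
    intro w hw
    obtain ⟨i, hi, rfl⟩ := List.getElem_of_mem ((hmem w).2 hw)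
    rw [List.formPerm_apply_getElem _ hnd]
    rw [hget, hget]
    by_cases h : i + 1 < l.length
    · simp only [Nat.mod_eq_of_lt h]
      exact p.adj_getVert_succ (by omega)
    · have h' : i + 1 = l.length := by omega
      simp only [h', Nat.mod_self]
      rw [hll, SimpleGraph.Walk.getVert_length]
      have := p.adj_getVert_succ (i := 0) (by omega)
      rwa [SimpleGraph.Walk.getVert_zero] at this
  have hs : ∀ w, l.formPerm w ≠ w ↔ w ∈ C.verts := by
    intro w
    constructor
    · intro h; exact (hmem w).1 (List.mem_of_formPerm_apply_ne h)
    · intro h h'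
      have := hadj w h
      rw [h'] at this
      exact this.ne rfl
  have hc : l.formPerm.IsCycle := List.isCycle_formPerm hnd (by omega)
  have hcard : 3 ≤ l.formPerm.support.card := by
    rw [List.support_formPerm_of_nodup l hnd, List.toFinset_card_of_nodup hnd]
    · omega
    · intro x hx; rw [hx] at hll; simp at hll; omega
  refine ⟨l.formPerm, ⟨hc, (hs v).2 hv, hcard, fun w hw => (hadj w ((hs w).1 hw)).adj_sub.symm⟩, ?_⟩
  have hle : ∀ a b, (cycSub G l.formPerm).Adj a b → C.Adj a b := by
    rintro a b ⟨h, h' | h'⟩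
    · rw [← h']; refine hadj a ((hs a).1 ?_); rw [h']; exact h.ne'
    · rw [← h']; refine (hadj b ((hs b).1 ?_)).symm; rw [h']; exact h.ne
  have hgood : GoodCyc G v l.formPerm :=
    ⟨hc, (hs v).2 hv, hcard, fun w hw => (hadj w ((hs w).1 hw)).adj_sub.symm⟩
  ext a b
  · exact hs a
  · refine ⟨hle a b, fun hab => ?_⟩
    have ha : a ∈ C.verts := hab.fst_mem
    have e : (cycSub G l.formPerm).neighborSet a = C.neighborSet a := by
      apply Set.eq_of_subset_of_ncard_le
      · intro x hx; exact hle a x hx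
      · rw [hdeg a ha, hgood.isCycleSub.2.2 a ((hs a).2 ha)]
      · exact Set.toFinite _
    have : b ∈ C.neighborSet a := hab
    rw [← e] at this
    exact this

theorem swap_of_card_two {c : Equiv.Perm V} {v : V} (h : c.support.card = 2) (hv : c v ≠ v) :
    ∃ u, u ≠ v ∧ c = Equiv.swap v u := by
  obtain ⟨x, y, hxy, rfl⟩ := Equiv.Perm.card_support_eq_two.1 h
  have : v = x ∨ v = y := by
    by_contra h'
    push Not at h'
    exact hv (Equiv.swap_apply_of_ne_of_ne h'.1 h'.2)
  rcases this with rfl | rfl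
  · exact ⟨y, hxy.symm, rfl⟩
  · exact ⟨x, hxy, Equiv.swap_comm _ _⟩

theorem aAlpha_charpoly_vertex_recursion
    {V : Type*} [Fintype V] [DecidableEq V]
    (G : SimpleGraph V) [DecidableRel G.Adj] (α : ℝ) (h0 : 0 ≤ α) (h1 : α ≤ 1) (v : V) :
    phi (aAlpha α G) =
      (Polynomial.X - Polynomial.C α * (G.degree v : Polynomial ℝ)) *
          phi (delSub (aAlpha α G) {v})
        - Polynomial.C ((1 - α) ^ 2) *
            ∑ u ∈ G.neighborFinset v, phi (delSub (aAlpha α G) {u, v})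
        - 2 * ∑ᶠ C ∈ {C : G.Subgraph | IsCycleSub G C ∧ v ∈ C.verts},
          Polynomial.C ((1 - α) ^ C.verts.ncard) * phi (delSub (aAlpha α G) C.verts) := by
  simp only [phi_delSub]
  unfold phi
  set M := (Polynomial.X : Polynomial ℝ) • (1 : Matrix V V (Polynomial ℝ)) - aAlpha α G with hMdef
  have hM : ∀ i j, i ≠ j → M i j = if G.Adj i j then -Polynomial.C (1 - α) else 0 := by
    intro i j hij
    simp only [hMdef, aAlpha, degMat, Matrix.sub_apply, Matrix.add_apply, Matrix.smul_apply,
      Matrix.one_apply_ne hij, Matrix.diagonal_apply_ne _ hij, SimpleGraph.adjMatrix_apply,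
      smul_eq_mul]
    split_ifs <;> simp
  have hMv : M v v = Polynomial.X - Polynomial.C α * (G.degree v : Polynomial ℝ) := by
    simp [hMdef, aAlpha, degMat]
  have hK : ∀ c : Equiv.Perm V, c.cycleOf v = c → c ≠ 1 → c v ≠ v ∧ c.IsCycle := by
    intro c hc hc1
    have : c v ≠ v := fun h => hc1 (by rw [← hc]; exact (Equiv.Perm.cycleOf_eq_one_iff c).2 h)
    exact ⟨this, by rw [← hc]; exact Equiv.Perm.isCycle_cycleOf c this⟩
  rw [det_expand' M v]
  set t : Equiv.Perm V → Polynomial ℝ := fun c =>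
    (Equiv.Perm.sign c • ∏ i ∈ insert v c.support, M (c i) i) *
        dd M ((insert v c.support : Finset V) : Set V) with ht
  set K : Finset (Equiv.Perm V) := Finset.univ.filter fun c => c.cycleOf v = c with hKdef
  have hsplit : ∑ c ∈ K, t c = t 1 + ∑ c ∈ K with c.support.card = 2, t c
      + ∑ c ∈ K with 3 ≤ c.support.card, t c := by
    rw [← Finset.sum_filter_add_sum_filter_not K (fun c => 3 ≤ c.support.card), add_comm]
    congr 1
    rw [← Finset.sum_filter_add_sum_filter_not _ (fun c : Equiv.Perm V => c.support.card = 2),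
      add_comm, Finset.filter_filter, Finset.filter_filter]
    congr 1
    · rw [← Finset.sum_singleton t 1]
      refine Finset.sum_congr ?_ fun _ _ => rfl
      ext c
      simp only [hKdef, Finset.mem_filter, Finset.mem_univ, true_and, Finset.mem_singleton]
      constructor
      · rintro ⟨_, h2, h3⟩
        by_contra h
        have := Equiv.Perm.two_le_card_support_of_ne_one h
        omega
      · rintro rfl
        simp [Equiv.Perm.cycleOf_one]
    · refine Finset.sum_congr ?_ fun _ _ => rfl
      ext c
      simp only [Finset.mem_filter]
      constructor
      · rintro ⟨⟨h, _⟩, h'⟩; exact ⟨h, h'⟩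
      · rintro ⟨h, h'⟩; exact ⟨⟨h, by omega⟩, h'⟩
  have hzero : ∀ c : Equiv.Perm V, ∀ w, c w ≠ w → ¬ G.Adj (c w) w → t c = 0 := by
    intro c w hw hn
    have : ∏ i ∈ insert v c.support, M (c i) i = 0 :=
      Finset.prod_eq_zero (i := w) (by simp [hw]) (by rw [hM _ _ hw, if_neg hn])
    simp only [ht, this, smul_zero, zero_mul]
  have ht1 : t 1 = (Polynomial.X - Polynomial.C α * (G.degree v : Polynomial ℝ)) *
      dd M {v} := by
    simp only [ht]
    have e : ((insert v (1 : Equiv.Perm V).support : Finset V) : Set V) = {v} := by simp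
    rw [e, ← hMv]
    simp
  have ht2 : ∑ c ∈ K with c.support.card = 2, t c =
      - (Polynomial.C ((1 - α) ^ 2) * ∑ u ∈ G.neighborFinset v, dd M {u, v}) := by
    have hsub : (G.neighborFinset v).image (fun u => Equiv.swap v u) ⊆
        K.filter fun c => c.support.card = 2 := by
      intro c hc
      simp only [Finset.mem_image, SimpleGraph.mem_neighborFinset] at hc
      obtain ⟨u, hu, rfl⟩ := hc
      simp only [hKdef, Finset.mem_filter, Finset.mem_univ, true_and]
      refine ⟨(Equiv.Perm.isCycle_swap hu.ne).cycleOf_eq ?_,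
        Equiv.Perm.card_support_swap hu.ne⟩
      simpa using hu.ne'
    rw [← Finset.sum_subset hsub, Finset.sum_image]
    · rw [Finset.mul_sum, ← Finset.sum_neg_distrib]
      refine Finset.sum_congr rfl fun u hu => ?_
      rw [SimpleGraph.mem_neighborFinset] at hu
      have e : insert v (Equiv.swap v u).support = {u, v} := by
        rw [Equiv.Perm.support_swap hu.ne]
        ext; simp; tauto
      have e' : (({u, v} : Finset V) : Set V) = {u, v} := by simp
      simp only [ht]
      rw [e, e', Equiv.Perm.sign_swap hu.ne, Finset.prod_pair hu.ne', Equiv.swap_apply_left,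
        Equiv.swap_apply_right, hM _ _ hu.ne, hM _ _ hu.ne', if_pos hu, if_pos hu.symm]
      rw [Units.smul_def, zsmul_eq_mul, Polynomial.C_pow]
      push_cast
      ring
    · intro a ha b hb hab
      have := congrArg (fun c : Equiv.Perm V => c v) hab
      simpa using this
    · intro c hc hn
      simp only [hKdef, Finset.mem_filter, Finset.mem_univ, true_and] at hc
      have hc1 : c ≠ 1 := by rintro rfl; simp at hc
      obtain ⟨u, hu, rfl⟩ := swap_of_card_two hc.2 (hK c hc.1 hc1).1
      apply hzero _ v (by simpa using hu)
      intro h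
      apply hn
      refine Finset.mem_image_of_mem _ ?_
      rw [SimpleGraph.mem_neighborFinset]
      simpa using h.symm
  have hgoodval : ∀ c, GoodCyc G v c → t c =
      -(Polynomial.C ((1 - α) ^ (cycSub G c).verts.ncard) *
        dd M (cycSub G c).verts) := by
    rintro c ⟨g1, g2, g3, g4⟩
    have e : insert v c.support = c.support := Finset.insert_eq_of_mem (by simpa using g2)
    have e2 : ((c.support : Finset V) : Set V) = (cycSub G c).verts := by
      ext w
      rw [Finset.mem_coe, Equiv.Perm.mem_support]; rfl
    have e3 : ∏ i ∈ c.support, M (c i) i = (-Polynomial.C (1 - α)) ^ c.support.card := by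
      rw [← Finset.prod_const]
      refine Finset.prod_congr rfl fun i hi => ?_
      rw [Equiv.Perm.mem_support] at hi
      rw [hM _ _ hi, if_pos (g4 i hi)]
    simp only [ht]
    rw [e, e3, ← e2, Set.ncard_coe_finset, g1.sign, neg_pow (Polynomial.C (1 - α))]
    have e4 : ((-1 : Polynomial ℝ) ^ c.support.card) * (-1) ^ c.support.card = 1 := by
      rw [← mul_pow]; simp
    rw [Units.smul_def, zsmul_eq_mul]
    push_cast
    rw [Polynomial.C_pow]
    linear_combination (-((Polynomial.C (1 - α)) ^ c.support.card) *
      dd M ((c.support : Finset V) : Set V)) * e4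
  have hfin : {C : G.Subgraph | IsCycleSub G C ∧ v ∈ C.verts}.Finite := Set.toFinite _
  have ht3 : ∑ c ∈ K with 3 ≤ c.support.card, t c =
      - (2 * ∑ᶠ C ∈ {C : G.Subgraph | IsCycleSub G C ∧ v ∈ C.verts},
          Polynomial.C ((1 - α) ^ C.verts.ncard) * dd M C.verts) := by
    have hsub : (Finset.univ.filter fun c => GoodCyc G v c) ⊆
        K.filter fun c => 3 ≤ c.support.card := by
      intro c hc
      simp only [hKdef, Finset.mem_filter, Finset.mem_univ, true_and] at hc ⊢
      exact ⟨hc.1.cycleOf_eq hc.2.1, hc.2.2.1⟩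
    rw [← Finset.sum_subset hsub, finsum_mem_eq_finite_toFinset_sum _ hfin,
      ← Finset.sum_fiberwise_of_maps_to (g := cycSub G) (t := hfin.toFinset)]
    · rw [Finset.mul_sum, ← Finset.sum_neg_distrib]
      refine Finset.sum_congr rfl fun C hC => ?_
      rw [Set.Finite.mem_toFinset] at hC
      obtain ⟨c, hc, rfl⟩ := exists_good hC.1 hC.2
      have e : (Finset.univ.filter fun d => GoodCyc G v d).filter
          (fun d => cycSub G d = cycSub G c) = {c, c⁻¹} := by
        ext d
        simp only [Finset.mem_filter, Finset.mem_univ, true_and, Finset.mem_insert,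
          Finset.mem_singleton]
        constructor
        · rintro ⟨hd, hdc⟩
          exact hc.fiber hd hdc.symm
        · rintro (rfl | rfl)
          · exact ⟨hc, rfl⟩
          · exact ⟨hc.inv, cycSub_inv G c⟩
      rw [e, Finset.sum_pair hc.ne_inv, hgoodval c hc, hgoodval _ hc.inv, cycSub_inv]
      ring
    · intro c hc
      simp only [Finset.mem_filter, Finset.mem_univ, true_and] at hc
      rw [Set.Finite.mem_toFinset]
      exact ⟨hc.isCycleSub, hc.2.1⟩
    · intro c hc hn
      simp only [hKdef, Finset.mem_filter, Finset.mem_univ, true_and] at hc hn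
      have hc1 : c ≠ 1 := by rintro rfl; simp at hc
      obtain ⟨k1, k2⟩ := hK c hc.1 hc1
      by_contra hne
      exact hn ⟨k2, k1, hc.2, fun w hw => by
        by_contra hadj
        exact hne (hzero c w hw hadj)⟩
  rw [hsplit, ht1, ht2, ht3]
  ring
end
end
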